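/- arXiv:1211.3426 — 4 statements merged into one kernel-verified Lean document; each statement's English description precedes it below -/
import Mathlib

section
/- Let n ≥ 1 be an integer and let X be a real Banach space such that, for some λ > 1, X does not contain any subspace λ-isomorphic to ℓ¹_{n+1}. Then there exists a real number 0 < ρ < 2 such that for every finite collection P_1, …, P_n of mutually commuting norm-one projections on X (i.e. bounded linear operators with P_k ∘ P_k = P_k, ‖P_k‖_{X→X} = 1, and P_j ∘ P_k = P_k ∘ P_j for all j, k), one has ‖(Id_X − P_1)(Id_X − P_2) ⋯ (Id_X − P_n)‖_{X→X} ≤ ρ^n. -/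
/-- A sum of real numbers, each at most one, that is within `δ` of the number of its terms
has every term at least `1 - δ`. -/
theorem Finset.one_sub_le_of_card_sub_le_sum {ι : Type*} (s : Finset ι) (f : ι → ℝ) (δ : ℝ)
    (hf : ∀ i ∈ s, f i ≤ 1) (hsum : (s.card : ℝ) - δ ≤ ∑ i ∈ s, f i) {i : ι} (hi : i ∈ s) :
    1 - δ ≤ f i := by
  have h := Finset.single_le_sum (f := fun i => 1 - f i)
    (fun j hj => sub_nonneg.2 (hf j hj)) hi
  simp only [Finset.sum_sub_distrib, Finset.sum_const, nsmul_eq_mul, mul_one] at h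
  linarith

section CommutingIdempotents

variable {ι A : Type*} [Fintype ι] [CommRing A] [Algebra ℝ A]

/-- If a linear functional `φ` is bounded by one on all partial products of the `p k` and almost
attains `2 ^ card ι` on `∏ k, (1 - p k)`, then it almost attains `(-1) ^ card s` on every partial
product over `s`. -/
theorem one_sub_le_neg_one_pow_mul_prod (p : ι → A) (φ : A →ₗ[ℝ] ℝ) (δ : ℝ)
    (hφ : ∀ s : Finset ι, |φ (∏ k ∈ s, p k)| ≤ 1)
    (h : 2 ^ Fintype.card ι - δ ≤ φ (∏ k, (1 - p k))) (s : Finset ι) :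
    1 - δ ≤ (-1) ^ s.card * φ (∏ k ∈ s, p k) := by
  have hexp : φ (∏ k, (1 - p k)) =
      ∑ t : Finset ι, (-1 : ℝ) ^ t.card * φ (∏ k ∈ t, p k) := by
    have : ∏ k, (1 - p k) = ∑ t : Finset ι, (-1 : ℝ) ^ t.card • ∏ k ∈ t, p k := by
      simp only [sub_eq_add_neg, Finset.prod_one_add, Finset.powerset_univ, Finset.prod_neg]
      refine Finset.sum_congr rfl fun t _ => ?_
      rcases neg_one_pow_eq_or ℝ t.card with h | h <;>
        rcases Nat.even_or_odd t.card with h' | h' <;> simp [h'.neg_one_pow]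
    rw [this, map_sum]
    simp
  refine Finset.one_sub_le_of_card_sub_le_sum Finset.univ
    (fun t : Finset ι => (-1 : ℝ) ^ t.card * φ (∏ k ∈ t, p k)) δ (fun t _ => ?_) ?_
    (Finset.mem_univ s)
  · refine (le_abs_self _).trans ?_
    rw [abs_mul, abs_pow, abs_neg, abs_one, one_pow, one_mul]
    exact hφ t
  · rw [← hexp]
    simpa using h

/-- Multiplying by the partial product of the idempotents `p k` over the set where `a k ≥ 0`
turns `b + ∑ k, a k p k`, `b ≥ 0`, into an element on which a functional that almost
attains `2 ^ card ι` on `∏ k, (1 - p k)` is almost `b + ∑ k, |a k|` in absolute value. -/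
theorem exists_finset_le_abs_prod_mul (p : ι → A) (hp : ∀ k, p k * p k = p k)
    (φ : A →ₗ[ℝ] ℝ) (δ : ℝ)
    (hφ : ∀ s : Finset ι, |φ (∏ k ∈ s, p k)| ≤ 1)
    (h : 2 ^ Fintype.card ι - δ ≤ φ (∏ k, (1 - p k))) (b : ℝ) (hb : 0 ≤ b) (a : ι → ℝ) :
    ∃ s : Finset ι, (1 - δ) * (b + ∑ k, |a k|) ≤
      |φ ((∏ k ∈ s, p k) * (b • 1 + ∑ k, a k • p k))| := by
  have key := one_sub_le_neg_one_pow_mul_prod p φ δ hφ h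
  classical
  let s : Finset ι := Finset.univ.filter fun k => 0 ≤ a k
  refine ⟨s, ?_⟩
  have hterm : ∀ k, (1 - δ) * |a k| ≤
      (-1) ^ s.card * (a k * φ ((∏ j ∈ s, p j) * p k)) := by
    intro k
    by_cases hk : 0 ≤ a k
    · have hks : k ∈ s := by simp [s, hk]
      have hmul : (∏ j ∈ s, p j) * p k = ∏ j ∈ s, p j := by
        rw [← Finset.prod_erase_mul s p hks, mul_assoc, hp]
      rw [hmul, abs_of_nonneg hk]
      nlinarith [mul_le_mul_of_nonneg_right (key s) hk]
    · have hks : k ∉ s := by simpa [s] using hk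
      have hmul : (∏ j ∈ s, p j) * p k = ∏ j ∈ insert k s, p j := by
        rw [Finset.prod_insert hks, mul_comm]
      have hki := key (insert k s)
      rw [Finset.card_insert_of_notMem hks, pow_succ] at hki
      rw [hmul, abs_of_neg (not_le.1 hk)]
      nlinarith [mul_le_mul_of_nonneg_right hki (neg_nonneg.2 (not_le.1 hk).le)]
  have hsum := Finset.sum_le_sum fun k (_ : k ∈ Finset.univ) => hterm k
  rw [← Finset.mul_sum, ← Finset.mul_sum] at hsum
  have hval : φ ((∏ k ∈ s, p k) * (b • 1 + ∑ k, a k • p k)) =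
      b * φ (∏ k ∈ s, p k) + ∑ k, a k * φ ((∏ j ∈ s, p j) * p k) := by
    simp [mul_add, Finset.mul_sum]
  calc (1 - δ) * (b + ∑ k, |a k|)
      ≤ (-1) ^ s.card * φ ((∏ k ∈ s, p k) * (b • 1 + ∑ k, a k • p k)) := by
        rw [hval]
        nlinarith [mul_le_mul_of_nonneg_right (key s) hb]
    _ ≤ _ := by
        refine (le_abs_self _).trans ?_
        rw [abs_mul, abs_pow, abs_neg, abs_one, one_pow, one_mul]

end CommutingIdempotents

open scoped IsMulCommutative in
/-- If commuting contractive projections `P k` are such that `‖∏ k, (1 - P k)‖ > 2 ^ n - δ`, then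
for some `x` in the unit ball the vectors `x, P 0 x, …, P (n - 1) x` satisfy a lower
`ℓ¹`-estimate with constant `1 - δ`. -/
theorem exists_lower_l1_estimate_of_lt_norm_prod
    {X : Type*} [NormedAddCommGroup X] [NormedSpace ℝ X] {n : ℕ} {δ : ℝ}
    (P : Fin n → X →L[ℝ] X) (hP : ∀ k, P k * P k = P k)
    (hnorm : ∀ k, ‖P k‖ ≤ 1) (hcomm : ∀ j k, P j * P k = P k * P j)
    (h : 2 ^ n - δ < ‖(List.ofFn fun k : Fin n => (1 : X →L[ℝ] X) - P k).prod‖) :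
    ∃ x : X, ‖x‖ ≤ 1 ∧ ∀ (b : ℝ) (a : Fin n → ℝ),
      (1 - δ) * (|b| + ∑ k, |a k|) ≤ ‖b • x + ∑ k, a k • P k x‖ := by
  obtain ⟨x, hx, hQx⟩ := ContinuousLinearMap.exists_lt_apply_of_lt_opNorm _ h
  obtain ⟨ξ, hξ, hξx⟩ := exists_dual_vector'' ℝ
    ((List.ofFn fun k : Fin n => (1 : X →L[ℝ] X) - P k).prod x)
  have : IsMulCommutative (Algebra.adjoin ℝ (Set.range P)) :=
    Algebra.isMulCommutative_adjoin ℝ (by rintro _ ⟨j, rfl⟩ _ ⟨k, rfl⟩; exact hcomm j k)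
  let ι : Algebra.adjoin ℝ (Set.range P) →ₐ[ℝ] (X →L[ℝ] X) :=
    (Algebra.adjoin ℝ (Set.range P)).val
  let p : Fin n → Algebra.adjoin ℝ (Set.range P) := fun k =>
    ⟨P k, Algebra.subset_adjoin ⟨k, rfl⟩⟩
  have hιp : ∀ k, ι (p k) = P k := fun k => rfl
  let φ : Algebra.adjoin ℝ (Set.range P) →ₗ[ℝ] ℝ :=
    { toFun := fun T => ξ (ι T x)
      map_add' := fun S T => by simp
      map_smul' := fun c T => by simp }
  have hprod : ∀ s : Finset (Fin n), ‖ι (∏ k ∈ s, p k)‖ ≤ 1 := by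
    intro s
    induction s using Finset.induction_on with
    | empty =>
      rw [Finset.prod_empty, map_one]
      exact ContinuousLinearMap.norm_id_le
    | insert k s hk ih =>
      rw [Finset.prod_insert hk, map_mul]
      exact (norm_mul_le _ _).trans (mul_le_one₀ (hnorm k) (norm_nonneg _) ih)
  have hξle : ∀ y, |ξ y| ≤ ‖y‖ := fun y => by
    simpa using ξ.le_of_opNorm_le hξ y
  have hcontr : ∀ (s : Finset (Fin n)) (y : X), |ξ (ι (∏ k ∈ s, p k) y)| ≤ ‖y‖ := fun s y =>
    (hξle _).trans (by simpa using (ι (∏ k ∈ s, p k)).le_of_opNorm_le (hprod s) y)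
  have hQ : ι (∏ k, (1 - p k)) = (List.ofFn fun k : Fin n => (1 : X →L[ℝ] X) - P k).prod := by
    rw [← List.prod_ofFn, map_list_prod, List.map_ofFn]
    congr 2
  have hbig : 2 ^ Fintype.card (Fin n) - δ ≤ φ (∏ k, (1 - p k)) := by
    change _ ≤ ξ (ι _ x)
    rw [hQ, hξx, Fintype.card_fin]
    exact hQx.le
  have hpos : ∀ (b : ℝ) (a : Fin n → ℝ), 0 ≤ b →
      (1 - δ) * (|b| + ∑ k, |a k|) ≤ ‖b • x + ∑ k, a k • P k x‖ := by
    intro b a hb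
    obtain ⟨s, hs⟩ := exists_finset_le_abs_prod_mul p (fun k => Subtype.ext (hP k)) φ δ
      (fun s => (hcontr s x).trans hx.le) hbig b hb a
    rw [abs_of_nonneg hb]
    refine hs.trans ?_
    change |ξ (ι _ x)| ≤ _
    rw [map_mul]
    refine (hcontr s _).trans (le_of_eq ?_)
    simp [hιp]
  refine ⟨x, hx.le, fun b a => ?_⟩
  rcases le_total 0 b with hb | hb
  · exact hpos b a hb
  · have := hpos (-b) (fun k => -a k) (neg_nonneg.2 hb)
    simpa only [abs_neg, neg_smul, Finset.sum_neg_distrib, ← neg_add, norm_neg] using this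

/-- **Pisier's projection lemma.**
Let `n ≥ 1` and let `X` be a real Banach space which, for some `λ > 1`, contains no subspace
`λ`-isomorphic to `ℓ¹_{n+1}`. Then there is `0 < ρ < 2` such that for any `n` mutually
commuting norm-one projections `P_1, …, P_n` on `X` one has
`‖(Id - P_1) ⋯ (Id - P_n)‖ ≤ ρ^n`. -/
theorem pisier_projection_lemma
    {X : Type*} [NormedAddCommGroup X] [NormedSpace ℝ X] [CompleteSpace X]
    (n : ℕ) (hn : 1 ≤ n)
    (lam : ℝ) (hlam : 1 < lam)
    (hX : ¬ ∃ u : (PiLp 1 fun _ : Fin (n + 1) => ℝ) →ₗ[ℝ] X,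
      ∀ x, ‖x‖ ≤ ‖u x‖ ∧ ‖u x‖ ≤ lam * ‖x‖) :
    ∃ ρ : ℝ, 0 < ρ ∧ ρ < 2 ∧
      ∀ P : Fin n → X →L[ℝ] X,
        (∀ k, P k * P k = P k) →
        (∀ k, ‖P k‖ = 1) →
        (∀ j k, P j * P k = P k * P j) →
        ‖(List.ofFn fun k : Fin n => (1 : X →L[ℝ] X) - P k).prod‖ ≤ ρ ^ n := by
  have hn0 : n ≠ 0 := by omega
  have hlam0 : 0 < lam := one_pos.trans hlam
  have hinv0 : 0 < lam⁻¹ := inv_pos.2 hlam0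
  have hinv1 : lam⁻¹ < 1 := inv_lt_one_of_one_lt₀ hlam
  have hpow : (1 : ℝ) ≤ 2 ^ n := one_le_pow₀ one_le_two
  have hbase : (0 : ℝ) < 2 ^ n - (1 - lam⁻¹) := by linarith
  have hρ : ((2 ^ n - (1 - lam⁻¹)) ^ ((n : ℝ)⁻¹)) ^ n = 2 ^ n - (1 - lam⁻¹) :=
    Real.rpow_inv_natCast_pow hbase.le hn0
  refine ⟨(2 ^ n - (1 - lam⁻¹)) ^ ((n : ℝ)⁻¹), Real.rpow_pos_of_pos hbase _, ?_, ?_⟩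
  · refine lt_of_pow_lt_pow_left₀ n zero_le_two ?_
    rw [hρ]
    linarith
  intro P hP hnorm hcomm
  rw [hρ]
  by_contra! hlt
  obtain ⟨x, hx, hlow⟩ := exists_lower_l1_estimate_of_lt_norm_prod P hP
    (fun k => (hnorm k).le) hcomm hlt
  apply hX
  let v : Fin (n + 1) → X := Fin.cons x fun k => P k x
  have hv : ∀ i, ‖v i‖ ≤ 1 := by
    refine Fin.cases hx fun k => ?_
    simpa [v, hnorm k] using ((P k).le_opNorm x).trans (by simpa [hnorm k] using hx)
  let u : (PiLp 1 fun _ : Fin (n + 1) => ℝ) →ₗ[ℝ] X :=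
    lam • (Fintype.linearCombination ℝ v ∘ₗ
      (WithLp.linearEquiv 1 ℝ (Fin (n + 1) → ℝ)).toLinearMap)
  have hu : ∀ y, ‖u y‖ = lam * ‖∑ i, y i • v i‖ := fun y => by
    simp [u, norm_smul, abs_of_pos hlam0, Fintype.linearCombination_apply]
  have hy : ∀ y : PiLp 1 fun _ : Fin (n + 1) => ℝ, ‖y‖ = ∑ i, |y i| := fun y => by
    simp [PiLp.norm_eq_of_L1]
  refine ⟨u, fun y => ⟨?_, ?_⟩⟩
  · have h := hlow (y 0) fun k => y k.succ
    rw [hu, hy, Fin.sum_univ_succ, Fin.sum_univ_succ]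
    rw [sub_sub_cancel, inv_mul_le_iff₀ hlam0] at h
    simpa [v] using h
  · rw [hu, hy]
    refine mul_le_mul_of_nonneg_left (norm_sum_le_of_le _ fun i _ => ?_) hlam0.le
    rw [norm_smul, Real.norm_eq_abs]
    exact mul_le_of_le_one_right (abs_nonneg _) (hv i)
end

section
/- Let X be a uniformly convex real Banach space. Then there exists λ > 1 such that X does not contain any subspace λ-isomorphic to ℓ¹_2, i.e. there is no linear map u : ℓ¹_2 → X satisfying ‖x‖ ≤ ‖u(x)‖ ≤ λ‖x‖ for all x ∈ ℓ¹_2. -/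
/-- A uniformly convex real Banach space does not contain, for some `λ > 1`, any subspace
`λ`-isomorphic to `ℓ¹_2` (that is, there is no linear map `u : ℓ¹_2 → X` with
`‖x‖ ≤ ‖u x‖ ≤ λ‖x‖` for all `x`). -/
theorem uniformConvex_not_contains_ell1_two
    {X : Type*} [NormedAddCommGroup X] [NormedSpace ℝ X] [UniformConvexSpace X] :
    ∃ lam : ℝ, 1 < lam ∧
      ¬ ∃ u : (PiLp 1 fun _ : Fin 2 => ℝ) →ₗ[ℝ] X,
        ∀ x, ‖x‖ ≤ ‖u x‖ ∧ ‖u x‖ ≤ lam * ‖x‖ := by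
  obtain ⟨δ, hδ, h⟩ := exists_forall_closed_ball_dist_add_le_two_sub X one_pos
  obtain ⟨t, ht, ht1, htδ⟩ : ∃ t : ℝ, 0 < t ∧ t ≤ 1 ∧ t ≤ δ / 4 :=
    ⟨min 1 (δ / 4), by positivity, min_le_left _ _, min_le_right _ _⟩
  refine ⟨1 + t, by linarith, ?_⟩
  rintro ⟨u, hu⟩
  have hl : 0 < 1 + t := by linarith
  have norm_eq (a b : ℝ) : ‖(!₁[a, b] : PiLp 1 fun _ : Fin 2 => ℝ)‖ = |a| + |b| := by
    simp [PiLp.norm_eq_of_L1]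
  have norm_smul_map (v : PiLp 1 fun _ : Fin 2 => ℝ) :
      ‖(1 + t)⁻¹ • u v‖ = ‖u v‖ / (1 + t) := by
    rw [norm_smul, Real.norm_of_nonneg (by positivity)]
    ring
  have norm_le_one {v : PiLp 1 fun _ : Fin 2 => ℝ} (hv : ‖v‖ = 1) :
      ‖(1 + t)⁻¹ • u v‖ ≤ 1 := by
    rw [norm_smul_map, div_le_one hl]
    simpa [hv] using (hu v).2
  have two_le {v : PiLp 1 fun _ : Fin 2 => ℝ} (hv : ‖v‖ = 2) :
      2 / (1 + t) ≤ ‖(1 + t)⁻¹ • u v‖ := by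
    rw [norm_smul_map, ← hv]
    gcongr
    exact (hu v).1
  have hsub : (!₁[1, 0] - !₁[0, 1] : PiLp 1 fun _ : Fin 2 => ℝ) = !₁[1, -1] := by
    ext i; fin_cases i <;> simp
  have hadd : (!₁[1, 0] + !₁[0, 1] : PiLp 1 fun _ : Fin 2 => ℝ) = !₁[1, 1] := by
    ext i; fin_cases i <;> simp
  have hle := h (norm_le_one (v := !₁[1, 0]) (by simp [norm_eq]))
    (norm_le_one (v := !₁[0, 1]) (by simp [norm_eq])) (by
      rw [← smul_sub, ← map_sub, hsub]
      refine le_trans ?_ (two_le (by rw [norm_eq]; norm_num))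
      rw [le_div_iff₀ hl]
      linarith)
  rw [← smul_add, ← map_add, hadd] at hle
  have hlt := (two_le (v := !₁[1, 1]) (by rw [norm_eq]; norm_num)).trans hle
  rw [div_le_iff₀ hl] at hlt
  nlinarith [mul_pos hδ ht]
end

section
/- Let X be a complex Banach space. Then the following are equivalent: (i) there exists λ > 1 such that for every integer n ≥ 1 there is a ℂ-linear map u : ℓ¹_n(ℂ) → X with ‖x‖ ≤ ‖u(x)‖ ≤ λ‖x‖ for all x ∈ ℓ¹_n(ℂ); (ii) there exists λ' > 1 such that for every integer n ≥ 1 there is an ℝ-linear map v : ℓ¹_n(ℝ) → X with ‖x‖ ≤ ‖v(x)‖ ≤ λ'‖x‖ for all x ∈ ℓ¹_n(ℝ). In other words, a complex Banach space contains the spaces ℓ¹_n uniformly (as complex subspaces) if and only if the underlying real Banach space contains the spaces ℓ¹_n uniformly (as real subspaces). -/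
/-- The fourth roots of unity, used as complex signs. -/
noncomputable def quarticSign (k : Fin 4) : ℂ := Complex.I ^ (k : ℕ)

lemma norm_quarticSign (k : Fin 4) : ‖quarticSign k‖ = 1 := by
  simp [quarticSign]

lemma quarticSign_add (k l : Fin 4) : quarticSign (k + l) = quarticSign k * quarticSign l := by
  rw [quarticSign, quarticSign, quarticSign, ← pow_add, Fin.val_add, ← Complex.I_pow_eq_pow_mod]

lemma exists_quarticSign_add_rev (k : Fin 4) : ∃ e : ℝ, |e| = 1 ∧
    quarticSign k + quarticSign k.rev = (1 - Complex.I) * (e : ℂ) := by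
  fin_cases k
  · exact ⟨1, by simp, by simp [quarticSign, Fin.rev, Complex.I_pow_three]; ring⟩
  · exact ⟨-1, by simp, by simp [quarticSign, Fin.rev]; ring⟩
  · exact ⟨-1, by simp, by simp [quarticSign, Fin.rev]; ring⟩
  · exact ⟨1, by simp, by simp [quarticSign, Fin.rev, Complex.I_pow_three]; ring⟩

lemma exists_norm_mul_quarticSign_sub_le (c : ℂ) (t : ℝ) (hc : ‖c‖ ≤ t) :
    ∃ k : Fin 4, ‖(t : ℂ) * quarticSign k - c‖ ≤ t - ‖c‖ / 5 := by
  obtain ⟨a, b⟩ := c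
  set r := ‖(⟨a, b⟩ : ℂ)‖ with hr
  have hr0 : 0 ≤ r := norm_nonneg _
  have hr2 : r ^ 2 = a ^ 2 + b ^ 2 := by
    rw [hr, Complex.sq_norm, Complex.normSq_mk]; ring
  have key : ∀ p q : ℝ, r ^ 2 = p ^ 2 + q ^ 2 → |q| ≤ p →
      t ^ 2 - 2 * t * p + r ^ 2 ≤ (t - r / 5) ^ 2 := by
    intro p q h hq
    have hp : 0 ≤ p := (abs_nonneg q).trans hq
    have hqp : q ^ 2 ≤ p ^ 2 := sq_le_sq' (by linarith [neg_abs_le q]) ((le_abs_self q).trans hq)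
    have hrp : 17 / 25 * r ≤ p := abs_le_of_sq_le_sq' (by nlinarith) hp |>.2
    nlinarith [mul_nonneg hr0 (sub_nonneg.2 hc),
      mul_nonneg (hr0.trans hc) (sub_nonneg.2 hrp)]
  have fin : ∀ k : Fin 4, ‖(t : ℂ) * quarticSign k - ⟨a, b⟩‖ ^ 2 ≤ (t - r / 5) ^ 2 →
      ∃ k : Fin 4, ‖(t : ℂ) * quarticSign k - ⟨a, b⟩‖ ≤ t - r / 5 :=
    fun k hk => ⟨k, abs_le_of_sq_le_sq' hk (by linarith) |>.2⟩
  rcases le_total |b| |a| with h | h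
  · rcases abs_cases a with ⟨ha, -⟩ | ⟨ha, -⟩
    · refine fin 0 (le_trans (le_of_eq ?_) (key a b hr2 (ha ▸ h)))
      rw [Complex.sq_norm, Complex.normSq_apply, hr2]
      simp [quarticSign]
      ring
    · refine fin 2 (le_trans (le_of_eq ?_) (key (-a) b (by rw [hr2]; ring) (ha ▸ h)))
      rw [Complex.sq_norm, Complex.normSq_apply, hr2]
      simp [quarticSign]
      ring
  · rcases abs_cases b with ⟨hb, -⟩ | ⟨hb, -⟩
    · refine fin 1 (le_trans (le_of_eq ?_) (key b a (by rw [hr2]; ring) (hb ▸ h)))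
      rw [Complex.sq_norm, Complex.normSq_apply, hr2]
      simp [quarticSign]
      ring
    · refine fin 3 (le_trans (le_of_eq ?_) (key (-b) a (by rw [hr2]; ring) (hb ▸ h)))
      rw [Complex.sq_norm, Complex.normSq_apply, hr2]
      simp [quarticSign, Complex.I_pow_three]
      ring

section QuarticAverage

variable {X : Type*} [NormedAddCommGroup X] [NormedSpace ℂ X]

lemma norm_sum_quarticSign_smul_le {ι : Type*} [Fintype ι] (x : ι → X) (θ : ι → Fin 4) :
    ‖∑ i, quarticSign (θ i) • x i‖ ≤ ∑ i, ‖x i‖ :=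
  norm_sum_le_of_le _ fun i _ => by rw [norm_smul, norm_quarticSign, one_mul]

variable (X) in
/-- The mean of `‖∑ i, θ i • x i‖ ^ 2` over all choices of fourth roots of unity `θ i` is at most
`a * card ι * ∑ i, ‖x i‖ ^ 2`. For `a = 1` this always holds. -/
def QuarticMeanBound (ι : Type*) [Fintype ι] [DecidableEq ι] (a : ℝ) : Prop :=
  ∀ x : ι → X, ∑ θ : ι → Fin 4, ‖∑ i, quarticSign (θ i) • x i‖ ^ 2 ≤
    4 ^ Fintype.card ι * (a * Fintype.card ι * ∑ i, ‖x i‖ ^ 2)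

lemma QuarticMeanBound.of_equiv {ι κ : Type*} [Fintype ι] [DecidableEq ι] [Fintype κ]
    [DecidableEq κ] {a : ℝ} (h : QuarticMeanBound X ι a) (e : ι ≃ κ) :
    QuarticMeanBound X κ a := by
  intro x
  have := h (x ∘ e)
  simp only [Function.comp_apply] at this
  rw [← Fintype.card_congr e, ← e.sum_comp fun j => ‖x j‖ ^ 2,
    ← (e.arrowCongr (Equiv.refl (Fin 4))).sum_comp]
  convert this using 4 with θ
  rw [← e.sum_comp]
  simp

lemma QuarticMeanBound.prod {ι κ : Type*} [Fintype ι] [DecidableEq ι] [Fintype κ]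
    [DecidableEq κ] {a b : ℝ} (hb : 0 ≤ b)
    (hι : QuarticMeanBound X ι a) (hκ : QuarticMeanBound X κ b) :
    QuarticMeanBound X (κ × ι) (a * b) := by
  intro x
  set N : ℝ := 4 ^ Fintype.card κ with hN
  have hN0 : 0 < N := by positivity
  -- Multiplying the signs in each block by a common sign leaves the total unchanged.
  have shift : ∀ η : κ → Fin 4,
      ∑ θ : κ × ι → Fin 4, ‖∑ p, quarticSign (θ p) • x p‖ ^ 2 =
      ∑ θ : κ → ι → Fin 4,
        ‖∑ j, quarticSign (η j) • ∑ i, quarticSign (θ j i) • x (j, i)‖ ^ 2 := by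
    intro η
    rw [← (Equiv.curry κ ι (Fin 4)).symm.sum_comp,
      ← Equiv.sum_comp (Equiv.addLeft (fun (j : κ) (_ : ι) => η j))]
    refine Finset.sum_congr rfl fun θ _ => ?_
    rw [Fintype.sum_prod_type]
    simp [quarticSign_add, Finset.smul_sum, mul_smul, Function.uncurry]
  have block : ∀ j : κ, ∑ θ : κ → ι → Fin 4, ‖∑ i, quarticSign (θ j i) • x (j, i)‖ ^ 2 ≤
      (4 ^ Fintype.card ι) ^ Fintype.card κ * (a * Fintype.card ι * ∑ i, ‖x (j, i)‖ ^ 2) := by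
    intro j
    have hfib : ∑ θ : κ → ι → Fin 4, ‖∑ i, quarticSign (θ j i) • x (j, i)‖ ^ 2 =
        (4 ^ Fintype.card ι) ^ (Fintype.card κ - 1) *
          ∑ φ : ι → Fin 4, ‖∑ i, quarticSign (φ i) • x (j, i)‖ ^ 2 := by
      rw [← (Equiv.funSplitAt j (ι → Fin 4)).symm.sum_comp, Fintype.sum_prod_type,
        Finset.mul_sum]
      refine Finset.sum_congr rfl fun φ _ => ?_
      simp [Equiv.funSplitAt]
    have hcard : Fintype.card κ = (Fintype.card κ - 1) + 1 :=
      (Nat.sub_add_cancel (Fintype.card_pos_iff.2 ⟨j⟩)).symm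
    rw [hfib]
    conv_rhs => rw [hcard, pow_succ, mul_assoc]
    exact mul_le_mul_of_nonneg_left (hι _) (by positivity)
  have main : N * ∑ θ : κ × ι → Fin 4, ‖∑ p, quarticSign (θ p) • x p‖ ^ 2 ≤
      N * (4 ^ Fintype.card (κ × ι) * (a * b * Fintype.card (κ × ι) * ∑ p, ‖x p‖ ^ 2)) := by
    calc N * ∑ θ : κ × ι → Fin 4, ‖∑ p, quarticSign (θ p) • x p‖ ^ 2
        = ∑ η : κ → Fin 4, ∑ θ : κ × ι → Fin 4, ‖∑ p, quarticSign (θ p) • x p‖ ^ 2 := by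
          simp [hN]
      _ = ∑ θ : κ → ι → Fin 4, ∑ η : κ → Fin 4,
            ‖∑ j, quarticSign (η j) • ∑ i, quarticSign (θ j i) • x (j, i)‖ ^ 2 := by
          rw [Finset.sum_comm (s := (Finset.univ : Finset (κ → ι → Fin 4)))]
          exact Finset.sum_congr rfl fun η _ => shift η
      _ ≤ ∑ θ : κ → ι → Fin 4, N * (b * Fintype.card κ *
            ∑ j, ‖∑ i, quarticSign (θ j i) • x (j, i)‖ ^ 2) :=
          Finset.sum_le_sum fun θ _ => hκ _
      _ = N * (b * Fintype.card κ) * ∑ j, ∑ θ : κ → ι → Fin 4,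
            ‖∑ i, quarticSign (θ j i) • x (j, i)‖ ^ 2 := by
          rw [Finset.sum_comm, Finset.mul_sum]
          exact Finset.sum_congr rfl fun θ _ => by ring
      _ ≤ N * (b * Fintype.card κ) * ∑ j, (4 ^ Fintype.card ι) ^ Fintype.card κ *
            (a * Fintype.card ι * ∑ i, ‖x (j, i)‖ ^ 2) :=
          mul_le_mul_of_nonneg_left (Finset.sum_le_sum fun j _ => block j) (by positivity)
      _ = _ := by
          rw [Fintype.sum_prod_type, ← Finset.mul_sum, ← Finset.mul_sum, Fintype.card_prod,
            mul_comm (Fintype.card κ), pow_mul]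
          push_cast
          ring
  exact le_of_mul_le_mul_left main hN0

lemma QuarticMeanBound.pow {n : ℕ} {a : ℝ} (ha : 0 ≤ a) (h : QuarticMeanBound X (Fin n) a)
    (k : ℕ) : QuarticMeanBound X (Fin (n ^ k)) (a ^ k) := by
  induction k with
  | zero =>
    rw [pow_zero, pow_zero]
    intro x
    simp [norm_smul, norm_quarticSign]
  | succ k ih =>
    rw [pow_succ, pow_succ']
    exact (h.prod (pow_nonneg ha k) ih).of_equiv finProdFinEquiv

/-- Vectors spanning a real copy of `ℓ¹` have large mean over complex signs. -/
lemma card_sq_le_two_mul_sum_quarticSign {ι : Type*} [Fintype ι] [DecidableEq ι] (x : ι → X)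
    (hx : ∀ e : ι → ℝ, ∑ i, |e i| ≤ ‖∑ i, (e i : ℂ) • x i‖) :
    4 ^ Fintype.card ι * (Fintype.card ι : ℝ) ^ 2 ≤
      2 * ∑ θ : ι → Fin 4, ‖∑ i, quarticSign (θ i) • x i‖ ^ 2 := by
  have pair : ∀ θ : ι → Fin 4, (Fintype.card ι : ℝ) ^ 2 ≤
      ‖∑ i, quarticSign (θ i) • x i‖ ^ 2 + ‖∑ i, quarticSign (θ i).rev • x i‖ ^ 2 := by
    intro θ
    choose e he h using fun i => exists_quarticSign_add_rev (θ i)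
    have h1 := hx e
    simp only [he, Finset.sum_const, Finset.card_univ, nsmul_eq_mul, mul_one] at h1
    have h2 : ‖(1 - Complex.I) • ∑ i, (e i : ℂ) • x i‖ ≤
        ‖∑ i, quarticSign (θ i) • x i‖ + ‖∑ i, quarticSign (θ i).rev • x i‖ := by
      refine le_trans (le_of_eq ?_) (norm_add_le _ _)
      rw [← Finset.sum_add_distrib, Finset.smul_sum]
      simp only [← add_smul, h, mul_smul]
    have h3 : ‖(1 - Complex.I : ℂ)‖ ^ 2 = 2 := by
      rw [Complex.sq_norm, Complex.normSq_apply]; norm_num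
    rw [norm_smul] at h2
    have h4 : (Fintype.card ι : ℝ) ^ 2 ≤ ‖∑ i, (e i : ℂ) • x i‖ ^ 2 := by gcongr
    have h5 := pow_le_pow_left₀ (by positivity) h2 2
    rw [mul_pow, h3] at h5
    nlinarith [sq_nonneg (‖∑ i, quarticSign (θ i) • x i‖ - ‖∑ i, quarticSign (θ i).rev • x i‖)]
  have hsum := Finset.sum_le_sum fun θ (_ : θ ∈ (Finset.univ : Finset (ι → Fin 4))) => pair θ
  rw [Finset.sum_add_distrib] at hsum
  have hrev : ∑ θ : ι → Fin 4, ‖∑ i, quarticSign (θ i).rev • x i‖ ^ 2 =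
      ∑ θ : ι → Fin 4, ‖∑ i, quarticSign (θ i) • x i‖ ^ 2 := by
    rw [← ((Equiv.refl ι).arrowCongr Fin.revPerm).sum_comp
      fun θ : ι → Fin 4 => ‖∑ i, quarticSign (θ i) • x i‖ ^ 2]
    simp
  rw [hrev] at hsum
  simp at hsum
  linarith

/-- If the mean over complex signs is almost maximal, then every choice of signs is. -/
lemma exists_forall_le_norm_sum_quarticSign {n : ℕ} {δ : ℝ}
    (h : ¬ QuarticMeanBound X (Fin n) (1 - δ / 4 ^ n)) :
    ∃ x : Fin n → X, 0 < ∑ i, ‖x i‖ ^ 2 ∧ ∀ θ : Fin n → Fin 4,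
      (1 - δ) * (n * ∑ i, ‖x i‖ ^ 2) ≤ ‖∑ i, quarticSign (θ i) • x i‖ ^ 2 := by
  simp only [QuarticMeanBound, not_forall, not_le, Fintype.card_fin] at h
  obtain ⟨x, hx⟩ := h
  set S := ∑ i, ‖x i‖ ^ 2 with hS
  have hS0 : 0 ≤ S := by positivity
  have hub : ∀ θ : Fin n → Fin 4, ‖∑ i, quarticSign (θ i) • x i‖ ^ 2 ≤ n * S := by
    intro θ
    calc _ ≤ (∑ i, ‖x i‖) ^ 2 := by gcongr; exact norm_sum_quarticSign_smul_le x θ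
      _ ≤ n * S := by simpa using sq_sum_le_card_mul_sum_sq (s := Finset.univ) (f := fun i => ‖x i‖)
  refine ⟨x, hS0.lt_of_ne fun h0 => ?_, fun θ => ?_⟩
  · have := Finset.sum_nonpos fun θ (_ : θ ∈ (Finset.univ : Finset (Fin n → Fin 4))) =>
      (hub θ).trans_eq (by rw [← h0, mul_zero])
    rw [← h0] at hx
    linarith
  · have h1 := Finset.sum_le_sum fun θ' (_ : θ' ∈ Finset.univ.erase θ) => hub θ'
    rw [← Finset.add_sum_erase _ _ (Finset.mem_univ θ)] at hx
    rw [Finset.sum_const, Finset.card_erase_of_mem (Finset.mem_univ θ), nsmul_eq_mul,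
      Nat.cast_sub (Finset.card_pos.2 ⟨θ, Finset.mem_univ θ⟩)] at h1
    simp only [Finset.card_univ, Fintype.card_pi, Fintype.card_fin, Finset.prod_const,
      Nat.cast_pow, Nat.cast_ofNat, Nat.cast_one] at h1
    have h4 : (4 : ℝ) ^ n * ((1 - δ / 4 ^ n) * n * S) = 4 ^ n * (n * S) - δ * (n * S) := by
      field_simp
    rw [h4] at hx
    linarith

/-- Vectors all of whose complex sign combinations are almost as long as possible are equivalent,
up to scaling, to the basis of complex `ℓ¹`. -/
lemma ell1_bounds_of_forall_quarticSign {n : ℕ} (hn : 1 ≤ n) (x : Fin n → X) {s : ℝ} (hs : 0 < s)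
    (hS : ∑ i, ‖x i‖ ^ 2 = n * s ^ 2)
    (h : ∀ θ : Fin n → Fin 4, (n - 1 / 20) * s ≤ ‖∑ i, quarticSign (θ i) • x i‖) (c : Fin n → ℂ) :
    s / 20 * ∑ i, ‖c i‖ ≤ ‖∑ i, c i • x i‖ ∧ ‖∑ i, c i • x i‖ ≤ 3 / 2 * s * ∑ i, ‖c i‖ := by
  have hn0 : (0 : ℝ) < n := by exact_mod_cast hn
  have hP : ∑ i, ‖x i‖ ≤ n * s := by
    refine abs_le_of_sq_le_sq' ?_ (by positivity) |>.2
    have := sq_sum_le_card_mul_sum_sq (s := Finset.univ) (f := fun i => ‖x i‖)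
    simp only [Finset.card_univ, Fintype.card_fin, hS] at this
    linarith
  have hP' : (n - 1 / 20) * s ≤ ∑ i, ‖x i‖ :=
    (h 0).trans (norm_sum_quarticSign_smul_le x 0)
  have hdev : ∀ j, (‖x j‖ - s) ^ 2 ≤ (s / 2) ^ 2 := by
    intro j
    have h1 : (‖x j‖ - s) ^ 2 ≤ ∑ i, (‖x i‖ - s) ^ 2 :=
      Finset.single_le_sum (f := fun i => (‖x i‖ - s) ^ 2) (fun i _ => sq_nonneg _)
        (Finset.mem_univ j)
    have h2 : ∑ i, (‖x i‖ - s) ^ 2 = 2 * n * s ^ 2 - 2 * s * ∑ i, ‖x i‖ := by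
      simp only [sub_sq, Finset.sum_add_distrib, Finset.sum_sub_distrib, hS, ← Finset.sum_mul,
        ← Finset.mul_sum]
      simp
      ring
    nlinarith
  have hlo : ∀ j, s / 2 ≤ ‖x j‖ := fun j => by
    linarith [(abs_le_of_sq_le_sq' (hdev j) (by positivity)).1]
  have hhi : ∀ j, ‖x j‖ ≤ 3 / 2 * s := fun j => by
    linarith [(abs_le_of_sq_le_sq' (hdev j) (by positivity)).2]
  set t := ∑ i, ‖c i‖ with ht
  have ht0 : 0 ≤ t := by positivity
  have hct : ∀ i, ‖c i‖ ≤ t := fun i =>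
    Finset.single_le_sum (f := fun i => ‖c i‖) (fun i _ => norm_nonneg _) (Finset.mem_univ i)
  constructor
  · choose θ hθ using fun i => exists_norm_mul_quarticSign_sub_le (c i) t (hct i)
    have h1 : t * ‖∑ i, quarticSign (θ i) • x i‖ ≤
        ‖∑ i, c i • x i‖ + ‖∑ i, ((t : ℂ) * quarticSign (θ i) - c i) • x i‖ := by
      refine le_trans (le_of_eq ?_) (norm_add_le _ _)
      rw [← Finset.sum_add_distrib]
      simp only [← add_smul, add_sub_cancel, mul_smul]
      rw [← Finset.smul_sum, norm_smul, Complex.norm_real, Real.norm_of_nonneg ht0]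
    have h2 : ‖∑ i, ((t : ℂ) * quarticSign (θ i) - c i) • x i‖ ≤
        ∑ i, (t * ‖x i‖ - s / 10 * ‖c i‖) := by
      refine norm_sum_le_of_le _ fun i _ => ?_
      rw [norm_smul]
      nlinarith [mul_le_mul_of_nonneg_right (hθ i) (norm_nonneg (x i)),
        mul_le_mul_of_nonneg_left (hlo i) (norm_nonneg (c i))]
    rw [Finset.sum_sub_distrib, ← Finset.mul_sum, ← Finset.mul_sum, ← ht] at h2
    nlinarith [mul_le_mul_of_nonneg_left (h θ) ht0, mul_le_mul_of_nonneg_left hP ht0]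
  · rw [ht, Finset.mul_sum]
    refine norm_sum_le_of_le _ fun i _ => ?_
    rw [norm_smul, mul_comm]
    exact mul_le_mul_of_nonneg_right (hhi i) (norm_nonneg _)

lemma not_quarticMeanBound_of_real_ell1 {L : ℝ}
    (hv : ∀ n : ℕ, 1 ≤ n → ∃ v : (PiLp 1 fun _ : Fin n => ℝ) →ₗ[ℝ] X,
      ∀ x, ‖x‖ ≤ ‖v x‖ ∧ ‖v x‖ ≤ L * ‖x‖)
    {n : ℕ} (hn : 1 ≤ n) {a : ℝ} (ha0 : 0 ≤ a) (ha1 : a < 1) :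
    ¬ QuarticMeanBound X (Fin n) a := by
  intro h
  have hlim : Filter.Tendsto (fun k : ℕ => 2 * (a ^ k * L ^ 2)) Filter.atTop (nhds 0) := by
    simpa using ((tendsto_pow_atTop_nhds_zero_of_lt_one ha0 ha1).mul_const (L ^ 2)).const_mul 2
  obtain ⟨k, hk⟩ := (hlim.eventually_lt_const one_pos).exists
  set N := n ^ k with hN
  have hN1 : 1 ≤ N := Nat.one_le_pow _ _ hn
  have hN0 : (0 : ℝ) < N := by exact_mod_cast hN1
  obtain ⟨v, hv⟩ := hv N hN1
  set x : Fin N → X := fun i => v (WithLp.toLp 1 (Pi.single i 1)) with hx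
  have hxn : ∀ i, ‖x i‖ ≤ L := fun i => by
    refine (hv _).2.trans_eq ?_
    simp
  have hlow := card_sq_le_two_mul_sum_quarticSign x fun e => by
    have hsum : ∑ i, (e i : ℂ) • x i = v (WithLp.toLp 1 e) := by
      have he : WithLp.toLp 1 e =
          ∑ i, e i • (WithLp.toLp 1 (Pi.single i 1) : PiLp 1 fun _ : Fin N => ℝ) := by
        ext j
        simp [Pi.single_apply]
      rw [he, map_sum]
      simp [hx]
    rw [hsum]
    simpa [PiLp.norm_eq_of_L1] using (hv (WithLp.toLp 1 e)).1
  have hup := h.pow ha0 k x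
  simp only [Fintype.card_fin] at hlow hup
  have hsq : ∑ i, ‖x i‖ ^ 2 ≤ N * L ^ 2 := by
    have := Finset.sum_le_sum fun i (_ : i ∈ (Finset.univ : Finset (Fin N))) =>
      pow_le_pow_left₀ (norm_nonneg _) (hxn i) 2
    simpa using this
  have h4 : (0 : ℝ) < 4 ^ N := by positivity
  have hfin : (4 : ℝ) ^ N * (N : ℝ) ^ 2 * 1 ≤ 4 ^ N * (N : ℝ) ^ 2 * (2 * (a ^ k * L ^ 2)) := by
    calc (4 : ℝ) ^ N * (N : ℝ) ^ 2 * 1 ≤ 2 * (4 ^ N * (a ^ k * N * ∑ i, ‖x i‖ ^ 2)) := by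
          linarith
      _ ≤ 2 * (4 ^ N * (a ^ k * N * (N * L ^ 2))) := by gcongr
      _ = _ := by ring
  exact absurd (le_of_mul_le_mul_left hfin (by positivity)) (not_le.2 hk)

end QuarticAverage


/-- A complex Banach space contains the spaces `ℓ¹_n(ℂ)` uniformly (as complex subspaces)
if and only if the underlying real Banach space contains the spaces `ℓ¹_n(ℝ)` uniformly
(as real subspaces). -/
theorem contains_ell1n_uniformly_complex_iff_real
    {X : Type*} [NormedAddCommGroup X] [NormedSpace ℂ X] [CompleteSpace X] :
    (∃ lam : ℝ, 1 < lam ∧ ∀ n : ℕ, 1 ≤ n →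
      ∃ u : (PiLp 1 fun _ : Fin n => ℂ) →ₗ[ℂ] X,
        ∀ x, ‖x‖ ≤ ‖u x‖ ∧ ‖u x‖ ≤ lam * ‖x‖) ↔
    (∃ lam' : ℝ, 1 < lam' ∧ ∀ n : ℕ, 1 ≤ n →
      ∃ v : (PiLp 1 fun _ : Fin n => ℝ) →ₗ[ℝ] X,
        ∀ x, ‖x‖ ≤ ‖v x‖ ∧ ‖v x‖ ≤ lam' * ‖x‖) := by
  constructor
  · rintro ⟨L, hL, h⟩
    refine ⟨L, hL, fun n hn => ?_⟩
    obtain ⟨u, hu⟩ := h n hn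
    refine ⟨{ toFun := fun x => u (WithLp.toLp 1 fun i => (x i : ℂ))
              map_add' := fun x y => ?_
              map_smul' := fun r x => ?_ }, fun x => ?_⟩
    · rw [← map_add]
      congr 1
      ext i
      simp
    · rw [RingHom.id_apply, ← Complex.coe_smul r, ← map_smul]
      congr 1
      ext i
      simp
    · simpa [PiLp.norm_eq_of_L1] using hu (WithLp.toLp 1 fun i => (x i : ℂ))
  · rintro ⟨L, -, hv⟩
    refine ⟨30, by norm_num, fun n hn => ?_⟩
    have hn0 : (0 : ℝ) < n := by exact_mod_cast hn
    have hn1 : (1 : ℝ) ≤ n := by exact_mod_cast hn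
    have hδ : 1 / (20 * n) ≤ (1 : ℝ) := by
      rw [div_le_one (by positivity)]; linarith
    have h4 : 1 / (20 * n) / 4 ^ n ≤ (1 : ℝ) :=
      div_le_one_of_le₀ (hδ.trans (one_le_pow₀ (by norm_num))) (by positivity)
    obtain ⟨x, hS, hx⟩ := exists_forall_le_norm_sum_quarticSign (X := X)
      (not_quarticMeanBound_of_real_ell1 hv hn (a := 1 - 1 / (20 * n) / 4 ^ n)
        (sub_nonneg.2 h4) (sub_lt_self _ (by positivity)))
    set s := √((∑ i, ‖x i‖ ^ 2) / n) with hs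
    have hs0 : 0 < s := Real.sqrt_pos.2 (div_pos hS hn0)
    have hSs : ∑ i, ‖x i‖ ^ 2 = n * s ^ 2 := by
      rw [hs, Real.sq_sqrt (by positivity)]
      field_simp
    have bounds := ell1_bounds_of_forall_quarticSign hn x hs0 hSs fun θ => by
      refine abs_le_of_sq_le_sq' (le_trans ?_ (hx θ)) (norm_nonneg _) |>.2
      have h1 : (1 - 1 / (20 * n)) * (n * (n * s ^ 2)) = (n - 1 / 20) * n * s ^ 2 := by
        field_simp
      rw [hSs, h1, mul_pow, sq (n - 1 / 20 : ℝ)]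
      gcongr <;> linarith
    refine ⟨{ toFun := fun c => ((20 / s : ℝ) : ℂ) • ∑ i, c i • x i
              map_add' := fun c d => ?_
              map_smul' := fun r c => ?_ }, fun c => ?_⟩
    · simp [add_smul, Finset.sum_add_distrib]
    · simp only [PiLp.smul_apply, smul_eq_mul, mul_smul, ← Finset.smul_sum, RingHom.id_apply]
      exact smul_comm _ _ _
    · obtain ⟨h1, h2⟩ := bounds c
      have hs20 : 0 < 20 / s := by positivity
      simp only [LinearMap.coe_mk, AddHom.coe_mk, norm_smul, Complex.norm_real,
        Real.norm_of_nonneg hs20.le, PiLp.norm_eq_of_L1]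
      constructor
      · refine le_trans (le_of_eq ?_) (mul_le_mul_of_nonneg_left h1 hs20.le)
        field_simp
      · refine (mul_le_mul_of_nonneg_left h2 hs20.le).trans_eq ?_
        field_simp
        ring
end

section
/- Let X and Y be complex Banach spaces, and suppose that for some λ > 1 the space Y does not contain any subspace λ-isomorphic to ℓ¹_2 (over the real scalars). Let (T_t)_{t≥0} be a strongly continuous semigroup of contractions on X such that for every t > 0 there exist bounded linear operators π : X → Y and Q : Y → X with ‖π‖ ≤ 1, ‖Q‖ ≤ 1 and Q ∘ π = Id_X, and a norm-one projection P on Y (P ∘ P = P, ‖P‖_{Y→Y} = 1) such that T_t = Q ∘ P ∘ π. Then (T_t)_{t≥0} is a bounded analytic semigroup on X. -/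
open Set Filter Topology MeasureTheory FourierTransform

section Projection

variable {Y : Type*} [NormedAddCommGroup Y] [NormedSpace ℂ Y]

theorem le_norm_smul_sub_smul {c n a b : ℝ} {y w : Y} (hc : c ≤ 1) (hy : ‖y‖ ≤ n)
    (hw : ‖w‖ ≤ n) (hyw : (1 + c) * n ≤ ‖y - w‖) (ha : 0 ≤ a) (hb : 0 ≤ b) :
    c * n * (a + b) ≤ ‖a • y - b • w‖ := by
  have hn : 0 ≤ n := (norm_nonneg y).trans hy
  rcases le_total b a with h | h
  · have h1 : a • (y - w) = (a • y - b • w) - (a - b) • w := by module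
    have h2 : a * ‖y - w‖ ≤ ‖a • y - b • w‖ + (a - b) * ‖w‖ := by
      calc a * ‖y - w‖ = ‖a • (y - w)‖ := by rw [norm_smul, Real.norm_of_nonneg ha]
        _ ≤ ‖a • y - b • w‖ + ‖(a - b) • w‖ := by rw [h1]; exact norm_sub_le _ _
        _ = _ := by rw [norm_smul, Real.norm_of_nonneg (sub_nonneg.2 h)]
    nlinarith [mul_le_mul_of_nonneg_left hyw ha, mul_le_mul_of_nonneg_left hw (sub_nonneg.2 h),
      mul_nonneg (mul_nonneg hb hn) (sub_nonneg.2 hc)]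
  · have h1 : b • (y - w) = (a • y - b • w) + (b - a) • y := by module
    have h2 : b * ‖y - w‖ ≤ ‖a • y - b • w‖ + (b - a) * ‖y‖ := by
      calc b * ‖y - w‖ = ‖b • (y - w)‖ := by rw [norm_smul, Real.norm_of_nonneg hb]
        _ ≤ ‖a • y - b • w‖ + ‖(b - a) • y‖ := by rw [h1]; exact norm_add_le _ _
        _ = _ := by rw [norm_smul, Real.norm_of_nonneg (sub_nonneg.2 h)]
    nlinarith [mul_le_mul_of_nonneg_left hyw hb, mul_le_mul_of_nonneg_left hy (sub_nonneg.2 h),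
      mul_nonneg (mul_nonneg ha hn) (sub_nonneg.2 hc)]

/-- If `Y` contains no `lam`-isomorphic copy of the real space `ℓ¹_2`, then the complementary
projection of a contractive projection has norm bounded away from `2`. -/
theorem norm_one_sub_le_of_forall_not_ell_one {lam : ℝ} (hlam : 1 < lam)
    (hY : ¬ ∃ u : (PiLp 1 fun _ : Fin 2 => ℝ) →ₗ[ℝ] Y,
      ∀ x, ‖x‖ ≤ ‖u x‖ ∧ ‖u x‖ ≤ lam * ‖x‖)
    (P : Y →L[ℂ] Y) (hP : P ∘L P = P) (hP1 : ‖P‖ ≤ 1) : ‖1 - P‖ ≤ 1 + lam⁻¹ := by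
  have hlam0 : 0 < lam := one_pos.trans hlam
  have hc0 : 0 < lam⁻¹ := inv_pos.2 hlam0
  have hc1 : lam⁻¹ ≤ 1 := inv_le_one_of_one_le₀ hlam.le
  refine ContinuousLinearMap.opNorm_le_bound _ (by positivity) fun y => ?_
  by_contra! hlt
  change (1 + lam⁻¹) * ‖y‖ < ‖y - P y‖ at hlt
  have hPle : ∀ v, ‖P v‖ ≤ ‖v‖ := fun v => by simpa using P.le_of_opNorm_le hP1 v
  have hPP : P (P y) = P y := congrArg (fun A : Y →L[ℂ] Y => A y) hP
  have hy : 0 < ‖y‖ := by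
    rw [norm_pos_iff]
    rintro rfl
    simp at hlt
  have hPy : lam⁻¹ * ‖y‖ ≤ ‖P y‖ := by linarith [norm_sub_le y (P y)]
  have hPr : ∀ (a : ℝ) (v : Y), P (a • v) = a • P v := fun a v => by
    rw [← Complex.coe_smul, map_smul, Complex.coe_smul]
  have hsame : ∀ a b : ℝ, lam⁻¹ * ‖y‖ * |a + b| ≤ ‖a • y + b • P y‖ := fun a b => by
    calc lam⁻¹ * ‖y‖ * |a + b| ≤ ‖P y‖ * |a + b| := by gcongr
      _ = ‖P (a • y + b • P y)‖ := by
        rw [map_add, hPr, hPr, hPP, ← add_smul, norm_smul, Real.norm_eq_abs, mul_comm]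
      _ ≤ _ := hPle _
  have hlow : ∀ a b : ℝ, lam⁻¹ * ‖y‖ * (|a| + |b|) ≤ ‖a • y + b • P y‖ := by
    intro a b
    rcases le_total 0 a with ha | ha <;> rcases le_total 0 b with hb | hb
    · rw [abs_of_nonneg ha, abs_of_nonneg hb]
      simpa [abs_of_nonneg (add_nonneg ha hb)] using hsame a b
    · rw [abs_of_nonneg ha, abs_of_nonpos hb]
      simpa using le_norm_smul_sub_smul hc1 le_rfl (hPle y) hlt.le ha (neg_nonneg.2 hb)
    · rw [abs_of_nonpos ha, abs_of_nonneg hb]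
      have := le_norm_smul_sub_smul hc1 le_rfl (hPle y) hlt.le (neg_nonneg.2 ha) hb
      rwa [show a • y + b • P y = -((-a) • y - b • P y) by module, norm_neg]
    · rw [abs_of_nonpos ha, abs_of_nonpos hb]
      have := hsame a b
      rw [abs_of_nonpos (add_nonpos ha hb)] at this
      linarith
  let e (i : Fin 2) : (PiLp 1 fun _ : Fin 2 => ℝ) →ₗ[ℝ] ℝ :=
    (PiLp.proj (𝕜 := ℝ) 1 (fun _ : Fin 2 => ℝ) i).toLinearMap
  refine hY ⟨(lam * ‖y‖⁻¹) • ((e 0).smulRight y + (e 1).smulRight (P y)), fun x => ?_⟩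
  have hu : ‖(lam * ‖y‖⁻¹) • (x 0 • y + x 1 • P y)‖ =
      lam * ‖y‖⁻¹ * ‖x 0 • y + x 1 • P y‖ := by
    rw [norm_smul, Real.norm_of_nonneg (by positivity)]
  have hx : ‖x‖ = |x 0| + |x 1| := by simp [PiLp.norm_eq_of_L1]
  change ‖x‖ ≤ ‖(lam * ‖y‖⁻¹) • (x 0 • y + x 1 • P y)‖ ∧
    ‖(lam * ‖y‖⁻¹) • (x 0 • y + x 1 • P y)‖ ≤ lam * ‖x‖
  rw [hu, hx]
  constructor
  · calc |x 0| + |x 1| = lam * ‖y‖⁻¹ * (lam⁻¹ * ‖y‖ * (|x 0| + |x 1|)) := by field_simp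
      _ ≤ _ := by gcongr; exact hlow _ _
  · calc lam * ‖y‖⁻¹ * ‖x 0 • y + x 1 • P y‖ ≤ lam * ‖y‖⁻¹ * (|x 0| * ‖y‖ + |x 1| * ‖y‖) := by
          gcongr
          refine (norm_add_le _ _).trans ?_
          rw [norm_smul, norm_smul, Real.norm_eq_abs, Real.norm_eq_abs]
          gcongr
          exact hPle y
      _ = _ := by field_simp

end Projection

section Extension

variable {E : Type*} [NormedAddCommGroup E] [NormedSpace ℂ E] [CompleteSpace E]

/-- A function on `(0, ∞)` whose `n`-th derivative `G n` is bounded by `M * n! * (K / t) ^ n`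
extends to a bounded holomorphic function on a sector. -/
theorem exists_bounded_holomorphic_extension (G : ℕ → ℝ → E) {M K : ℝ} (hK : 0 < K)
    (hG : ∀ n t, 0 < t → HasDerivAt (G n) (G (n + 1) t) t)
    (hbd : ∀ n t, 0 < t → ‖G n t‖ ≤ M * n.factorial * (K / t) ^ n) :
    ∃ θ : ℝ, 0 < θ ∧ θ < Real.pi / 2 ∧ ∃ S : ℂ → E,
      DifferentiableOn ℂ S {z : ℂ | z ≠ 0 ∧ |Complex.arg z| < θ} ∧
      (∃ C : ℝ, ∀ z ∈ {z : ℂ | z ≠ 0 ∧ |Complex.arg z| < θ}, ‖S z‖ ≤ C) ∧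
      ∀ t : ℝ, 0 < t → S (t : ℂ) = G 0 t := by
  have hM : 0 ≤ M := by simpa using (norm_nonneg _).trans (hbd 0 1 one_pos)
  set c : ℕ → ℂ → ℂ := fun n z => (n.factorial : ℂ)⁻¹ * (z.im * Complex.I) ^ n with hcdef
  set c' : ℕ → ℂ → ℂ := fun n z =>
    (n.factorial : ℂ)⁻¹ * (n * (z.im * Complex.I) ^ (n - 1)) with hc'def
  set f : ℕ → ℂ → E := fun n z => c n z • G n z.re with hfdef
  set f' : ℕ → ℂ → ℂ →L[ℝ] E := fun n z =>
    Complex.reCLM.smulRight (c n z • G (n + 1) z.re) +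
      Complex.imCLM.smulRight ((c' n z * Complex.I) • G n z.re) with hf'def
  have hcn : ∀ n z, ‖c n z‖ = (n.factorial : ℝ)⁻¹ * |z.im| ^ n := fun n z => by
    simp [hcdef]
  have hcn' : ∀ n z, ‖c' n z‖ = (n.factorial : ℝ)⁻¹ * (n * |z.im| ^ (n - 1)) := fun n z => by
    simp [hc'def]
  have hq : ∀ z : ℂ, 0 < z.re → |z.im| * (2 * K) < z.re → |z.im| * (K / z.re) ≤ 1 / 2 := by
    intro z hz h
    rw [← mul_div_assoc, div_le_iff₀ hz]
    linarith
  have hfb : ∀ n (z : ℂ), 0 < z.re → |z.im| * (2 * K) < z.re → ‖f n z‖ ≤ M * (1 / 2) ^ n := by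
    intro n z hz h
    rw [norm_smul, hcn]
    calc (n.factorial : ℝ)⁻¹ * |z.im| ^ n * ‖G n z.re‖
        ≤ (n.factorial : ℝ)⁻¹ * |z.im| ^ n * (M * n.factorial * (K / z.re) ^ n) := by
          gcongr; exact hbd n _ hz
      _ = M * (|z.im| * (K / z.re)) ^ n := by
          have := n.factorial_pos
          rw [mul_pow]; field_simp
      _ ≤ _ := by gcongr; exact hq z hz h
  have hsum : Summable fun n : ℕ => M * (1 / 2 : ℝ) ^ n :=
    (summable_geometric_of_lt_one (by norm_num) (by norm_num)).mul_left M
  have hderiv : ∀ n (z : ℂ), 0 < z.re → HasFDerivAt (f n) (f' n z) z := by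
    intro n z hz
    have h1 : HasFDerivAt (fun z : ℂ => G n z.re)
        (Complex.reCLM.smulRight (G (n + 1) z.re)) z :=
      (HasFDerivAt.comp z (hG n z.re hz).hasFDerivAt Complex.reCLM.hasFDerivAt).congr_fderiv
        (by ext; simp)
    have h2 : HasDerivAt (fun y : ℝ => (n.factorial : ℂ)⁻¹ * (y * Complex.I) ^ n)
        (c' n z * Complex.I) z.im := by
      have h3 : HasDerivAt (fun y : ℝ => (y : ℂ) * Complex.I) Complex.I z.im := by
        simpa using (Complex.ofRealCLM.hasDerivAt (x := z.im)).mul_const Complex.I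
      refine ((h3.pow n).const_mul (n.factorial : ℂ)⁻¹).congr_deriv ?_
      simp [hc'def, mul_assoc]
    have h4 : HasFDerivAt (c n) (Complex.imCLM.smulRight (c' n z * Complex.I)) z :=
      (HasFDerivAt.comp z h2.hasFDerivAt Complex.imCLM.hasFDerivAt).congr_fderiv (by ext; simp)
    refine (h4.smul h1).congr_fderiv ?_
    ext h
    simp [hf'def, smul_comm (c n z) h.re, mul_smul (h.im : ℂ)]
  have hf'b : ∀ (r : ℝ) n (z : ℂ), 0 < r → r < z.re → |z.im| * (2 * K) < z.re →
      ‖c n z • G (n + 1) z.re‖ ≤ M * K / r * ((n + 1) * (1 / 2) ^ n) ∧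
      ‖(c' n z * Complex.I) • G n z.re‖ ≤ M * K / r * (2 * ((n + 1) * (1 / 2) ^ n)) := by
    intro r n z hr hrz h
    have hz := hr.trans hrz
    have hqz := hq z hz h
    rw [norm_smul, norm_smul, hcn, norm_mul (c' n z), Complex.norm_I, mul_one, hcn']
    constructor
    · calc (n.factorial : ℝ)⁻¹ * |z.im| ^ n * ‖G (n + 1) z.re‖
          ≤ (n.factorial : ℝ)⁻¹ * |z.im| ^ n *
            (M * (n + 1).factorial * (K / z.re) ^ (n + 1)) := by
            gcongr; exact hbd _ _ hz
        _ = M * K / z.re * ((n + 1) * (|z.im| * (K / z.re)) ^ n) := by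
            have := n.factorial_pos
            rw [mul_pow, Nat.factorial_succ, pow_succ]; push_cast; field_simp
        _ ≤ _ := by gcongr
    · rcases n with _ | n
      · simp; positivity
      calc ((n + 1).factorial : ℝ)⁻¹ * ((n + 1 : ℕ) * |z.im| ^ (n + 1 - 1)) * ‖G (n + 1) z.re‖
          ≤ ((n + 1).factorial : ℝ)⁻¹ * ((n + 1 : ℕ) * |z.im| ^ (n + 1 - 1)) *
            (M * (n + 1).factorial * (K / z.re) ^ (n + 1)) := by
            gcongr; exact hbd _ _ hz
        _ = M * K / z.re * ((n + 1) * (|z.im| * (K / z.re)) ^ n) := by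
            have := (n + 1).factorial_pos
            rw [mul_pow, pow_succ, Nat.add_sub_cancel]; push_cast; field_simp
        _ ≤ M * K / r * ((n + 1 + 1) * (1 / 2) ^ n) := by gcongr; linarith
        _ = _ := by rw [pow_succ]; push_cast; ring
  have hsum' : Summable fun n : ℕ => ((n : ℝ) + 1) * (1 / 2 : ℝ) ^ n := by
    simp_rw [add_mul, one_mul]
    refine Summable.add ?_ (summable_geometric_of_lt_one (by norm_num) (by norm_num))
    simpa using summable_pow_mul_geometric_of_norm_lt_one 1 (r := (1 / 2 : ℝ)) (by norm_num)
  have hsec : ∀ z ∈ {z : ℂ | z ≠ 0 ∧ |Complex.arg z| < Real.arctan (1 / (2 * K))},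
      0 < z.re ∧ |z.im| * (2 * K) < z.re := by
    rintro z ⟨hz0, hz⟩
    have hlt := hz.trans (Real.arctan_lt_pi_div_two _)
    have hre : 0 < z.re := by
      rcases Complex.abs_arg_lt_pi_div_two_iff.1 hlt with h | h
      · exact h
      · exact absurd h hz0
    refine ⟨hre, ?_⟩
    have htan : Real.tan |Complex.arg z| = |z.im| / z.re := by
      have hcos : 0 ≤ Real.cos |Complex.arg z| := by
        apply Real.cos_nonneg_of_neg_pi_div_two_le_of_le _ hlt.le
        linarith [abs_nonneg (Complex.arg z), Real.pi_pos]
      rcases le_total 0 (Complex.arg z) with h | h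
      · rw [abs_of_nonneg h, Complex.tan_arg, abs_of_nonneg (Complex.arg_nonneg_iff.1 h)]
      · rw [abs_of_nonpos h, Real.tan_neg, Complex.tan_arg]
        rcases h.lt_or_eq with h | h
        · rw [abs_of_neg (Complex.arg_neg_iff.1 h), neg_div]
        · simp [(Complex.arg_eq_zero_iff.1 h).2]
    have := Real.tan_lt_tan_of_nonneg_of_lt_pi_div_two (abs_nonneg _)
      (Real.arctan_lt_pi_div_two _) hz
    rw [htan, Real.tan_arctan, div_lt_div_iff₀ hre (by positivity)] at this
    linarith
  refine ⟨Real.arctan (1 / (2 * K)), Real.arctan_pos.2 (by positivity),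
    Real.arctan_lt_pi_div_two _, fun z => ∑' n, f n z, ?_, ⟨∑' n : ℕ, M * (1 / 2 : ℝ) ^ n, ?_⟩, ?_⟩
  · intro z hz
    obtain ⟨hre, him⟩ := hsec z hz
    set r := z.re / 2 with hr
    have hr0 : 0 < r := by positivity
    set U : Set ℂ := {w | r < w.re} ∩ {w | |w.im| * (2 * K) < w.re} with hU
    have hzU : z ∈ U := ⟨by simp [hr, hre], him⟩
    have hUo : IsOpen U := (isOpen_lt continuous_const Complex.continuous_re).inter
      (isOpen_lt (by fun_prop) Complex.continuous_re)
    have hUc : Convex ℝ U := by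
      refine (convex_halfSpace_re_gt r).inter ?_
      intro v hv w hw a b ha hb hab
      simp only [mem_ofPred_eq] at hv hw ⊢
      simp only [Complex.add_re, Complex.add_im, Complex.real_smul, Complex.re_ofReal_mul,
        Complex.im_ofReal_mul]
      have h1 : |a * v.im + b * w.im| ≤ a * |v.im| + b * |w.im| := by
        refine (abs_add_le _ _).trans ?_
        rw [abs_mul, abs_mul, abs_of_nonneg ha, abs_of_nonneg hb]
      rcases ha.eq_or_lt with rfl | ha
      · have : b = 1 := by linarith
        subst this
        simpa using hw
      · nlinarith [mul_lt_mul_of_pos_left hv ha, mul_le_mul_of_nonneg_left hw.le hb,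
          mul_le_mul_of_nonneg_right h1 (by positivity : 0 ≤ 2 * K)]
    have hb : ∀ n, ∀ w ∈ U, ‖f' n w‖ ≤ 3 * (M * K / r) * (((n : ℝ) + 1) * (1 / 2) ^ n) := by
      intro n w hw
      obtain ⟨h1, h2⟩ := hf'b r n w hr0 hw.1 hw.2
      refine (norm_add_le _ _).trans ?_
      rw [ContinuousLinearMap.norm_smulRight_apply, ContinuousLinearMap.norm_smulRight_apply,
        Complex.reCLM_norm, Complex.imCLM_norm]
      linarith
    have hus := hsum'.mul_left (3 * (M * K / r))
    have key := hasFDerivAt_tsum_of_isPreconnected hus hUo hUc.isPreconnected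
      (fun n w hw => hderiv n w (hr0.trans hw.1)) hb hzU
      (Summable.of_norm_bounded hsum fun n => hfb n z hre him) hzU
    have hsf' : Summable fun n => f' n z := Summable.of_norm_bounded hus fun n => hb n z hzU
    have hsa : Summable fun n => c n z • G (n + 1) z.re :=
      Summable.of_norm_bounded (hsum'.mul_left (M * K / r)) fun n =>
        (hf'b r n z hr0 hzU.1 hzU.2).1
    have hsb : Summable fun n => (c' n z * Complex.I) • G n z.re :=
      Summable.of_norm_bounded ((hsum'.mul_left 2).mul_left (M * K / r)) fun n =>
        (hf'b r n z hr0 hzU.1 hzU.2).2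
    have hshift : ∀ n, (c' (n + 1) z * Complex.I) • G (n + 1) z.re =
        Complex.I • (c n z • G (n + 1) z.re) := by
      intro n
      rw [smul_smul]
      congr 1
      have h1 : (n.factorial : ℂ) ≠ 0 := by exact_mod_cast n.factorial_ne_zero
      have h2 : (n : ℂ) + 1 ≠ 0 := by exact_mod_cast n.succ_ne_zero
      simp only [hc'def, hcdef, Nat.factorial_succ, Nat.add_sub_cancel]
      push_cast
      field_simp
    have hbsum : ∑' n, (c' n z * Complex.I) • G n z.re =
        Complex.I • ∑' n, c n z • G (n + 1) z.re := by
      rw [hsb.tsum_eq_zero_add, ← hsa.tsum_const_smul]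
      simp only [hshift]
      simp [hc'def]
    have hfd := hasFDerivAt_of_restrictScalars ℝ
      (f' := ContinuousLinearMap.toSpanSingleton ℂ (∑' n, c n z • G (n + 1) z.re)) key (by
        have happ : ∀ h : ℂ, (∑' n, f' n z) h = h.re • ∑' n, c n z • G (n + 1) z.re +
            h.im • ∑' n, (c' n z * Complex.I) • G n z.re := by
          intro h
          rw [← hsa.tsum_const_smul, ← hsb.tsum_const_smul, ← (hsa.const_smul _).tsum_add
            (hsb.const_smul _)]
          exact (hsf'.hasSum.mapL (ContinuousLinearMap.apply ℝ E h)).tsum_eq.symm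
        ext h
        rw [happ, hbsum, ContinuousLinearMap.coe_restrictScalars',
          ContinuousLinearMap.toSpanSingleton_apply]
        conv_lhs => rw [← Complex.re_add_im h]
        rw [add_smul, mul_smul, Complex.coe_smul, Complex.coe_smul])
    exact hfd.differentiableAt.differentiableWithinAt
  · intro z hz
    obtain ⟨hre, him⟩ := hsec z hz
    exact tsum_of_norm_bounded hsum.hasSum fun n => hfb n z hre him
  · intro t _
    change ∑' n, f n t = _
    rw [tsum_eq_single 0]
    · simp [hfdef, hcdef]
    · intro n hn
      simp [hfdef, hcdef, hn]

end Extension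

section Semigroup

variable {X : Type*} [NormedAddCommGroup X] [NormedSpace ℂ X]

/-- A strongly continuous semigroup of contractions indexed by `[0, ∞)`. -/
structure IsContractionSemigroup (T : ℝ → X →L[ℂ] X) : Prop where
  map_zero : T 0 = 1
  map_add : ∀ s t : ℝ, 0 ≤ s → 0 ≤ t → T (s + t) = T s ∘L T t
  norm_le : ∀ t : ℝ, 0 ≤ t → ‖T t‖ ≤ 1
  continuousOn : ∀ x : X, ContinuousOn (fun t : ℝ => T t x) (Ici (0 : ℝ))

/-- Continuous weights supported on `[0, ∞)` that are integrable against `exp (-s)`. -/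
structure IsLaplaceWeight (g : ℝ → ℝ) : Prop where
  continuous : Continuous g
  eq_zero : ∀ s ≤ 0, g s = 0
  integrable : Integrable fun s => g s * Real.exp (-s)

theorem IsLaplaceWeight.sub_translate {g : ℝ → ℝ} (hg : IsLaplaceWeight g) {τ : ℝ} (hτ : 0 ≤ τ) :
    IsLaplaceWeight fun s => g s - g (s - τ) where
  continuous := hg.continuous.sub (hg.continuous.comp (continuous_sub_right τ))
  eq_zero s hs := by rw [hg.eq_zero s hs, hg.eq_zero _ (by linarith), sub_zero]
  integrable := by
    have h := (hg.integrable.comp_sub_right τ).const_mul (Real.exp (-τ))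
    refine (hg.integrable.sub h).congr (ae_of_all _ fun s => ?_)
    have : Real.exp (-s) = Real.exp (-τ) * Real.exp (-(s - τ)) := by
      rw [← Real.exp_add]; ring_nf
    simp only [Pi.sub_apply, this]
    ring

theorem isLaplaceWeight_max_sq : IsLaplaceWeight fun s => max s 0 ^ 2 where
  continuous := by fun_prop
  eq_zero s hs := by simp [hs]
  integrable := by
    have h := Real.GammaIntegral_convergent (s := 3) (by norm_num)
    rw [← integrable_indicator_iff measurableSet_Ioi] at h
    refine h.congr (ae_of_all _ fun s => ?_)
    rcases lt_or_ge 0 s with hs | hs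
    · have : (3 : ℝ) - 1 = (2 : ℕ) := by norm_num
      simp only [indicator_of_mem (mem_Ioi.2 hs), max_eq_left hs.le, this, Real.rpow_natCast]
      ring
    · simp [hs]

/-- The Laplace transform at `1 + w * I` of the orbit of `x`, weighted by `g`. -/
noncomputable def weightedLaplace (T : ℝ → X →L[ℂ] X) (g : ℝ → ℝ) (w : ℝ) (x : X) : X :=
  ∫ s : ℝ, ((g s : ℂ) * Complex.exp (-((1 + w * Complex.I) * s))) • T (max s 0) x

theorem norm_exp_neg_one_add_mul_I (w s : ℝ) :
    ‖Complex.exp (-((1 + w * Complex.I) * s))‖ = Real.exp (-s) := by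
  simp [Complex.norm_exp]

theorem mul_norm_le_norm_add_smul {A : X →L[ℂ] X} {ε : ℝ} (hε1 : ε ≤ 1)
    (h : ‖1 - A‖ ≤ 2 - ε) {r : ℝ} (hr0 : 0 ≤ r) (hr1 : r ≤ 1) (y : X) :
    ε * ‖y‖ ≤ ‖y + (r : ℂ) • A y‖ := by
  have h1 : ‖y - A y‖ ≤ (2 - ε) * ‖y‖ := (1 - A).le_of_opNorm_le h y
  have h2 : (2 : ℝ) • y = (y + (r : ℂ) • A y) + (r • (y - A y) + (1 - r) • y) := by
    rw [Complex.coe_smul]; module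
  have h3 : 2 * ‖y‖ ≤ ‖y + (r : ℂ) • A y‖ + (r * ‖y - A y‖ + (1 - r) * ‖y‖) := by
    calc 2 * ‖y‖ = ‖(2 : ℝ) • y‖ := by rw [norm_smul]; norm_num
      _ ≤ _ := by
        rw [h2]
        refine (norm_add_le _ _).trans (add_le_add le_rfl ((norm_add_le _ _).trans ?_))
        rw [norm_smul, norm_smul, Real.norm_of_nonneg hr0, Real.norm_of_nonneg (sub_nonneg.2 hr1)]
  nlinarith [mul_le_mul_of_nonneg_left h1 hr0,
    mul_nonneg (mul_nonneg (sub_nonneg.2 hε1) (sub_nonneg.2 hr1)) (norm_nonneg y)]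

namespace IsContractionSemigroup

variable {T : ℝ → X →L[ℂ] X} (hT : IsContractionSemigroup T)

include hT

theorem norm_apply_le {t : ℝ} (ht : 0 ≤ t) (x : X) : ‖T t x‖ ≤ ‖x‖ := by
  simpa using (T t).le_of_opNorm_le (hT.norm_le t ht) x

theorem continuous_orbit (x : X) : Continuous fun s => T (max s 0) x :=
  (hT.continuousOn x).comp_continuous (by fun_prop) fun s => le_max_right s 0

theorem norm_weighted_le (g : ℝ → ℝ) (w s : ℝ) (x : X) :
    ‖((g s : ℂ) * Complex.exp (-((1 + w * Complex.I) * s))) • T (max s 0) x‖ ≤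
      |g s| * Real.exp (-s) * ‖x‖ := by
  rw [norm_smul, norm_mul, norm_exp_neg_one_add_mul_I, Complex.norm_real, Real.norm_eq_abs]
  gcongr
  exact hT.norm_apply_le (le_max_right _ _) x

theorem integrable_weighted {g : ℝ → ℝ} (hg : IsLaplaceWeight g) (w : ℝ) (x : X) :
    Integrable fun s : ℝ =>
      ((g s : ℂ) * Complex.exp (-((1 + w * Complex.I) * s))) • T (max s 0) x := by
  refine (hg.integrable.norm.mul_const ‖x‖).mono' ?_ (ae_of_all _ fun s => ?_)
  · have := hg.continuous
    have hc : Continuous fun s : ℝ => (g s : ℂ) * Complex.exp (-((1 + w * Complex.I) * s)) := by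
      fun_prop
    exact (hc.smul (hT.continuous_orbit x)).aestronglyMeasurable
  · simpa [abs_mul] using hT.norm_weighted_le g w s x

theorem norm_weightedLaplace_le {g : ℝ → ℝ} (hg : IsLaplaceWeight g) (w : ℝ) (x : X) :
    ‖weightedLaplace T g w x‖ ≤ (∫ s, |g s| * Real.exp (-s)) * ‖x‖ := by
  rw [← integral_mul_const]
  refine norm_integral_le_of_norm_le ?_ (ae_of_all _ fun s => hT.norm_weighted_le g w s x)
  refine Integrable.mul_const ?_ _
  simpa [abs_mul] using hg.integrable.norm

theorem norm_weightedLaplace_le_of_support {g : ℝ → ℝ} {r M : ℝ} (hr : 0 ≤ r)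
    (h0 : ∀ s ≤ 0, g s = 0) (h1 : ∀ s, r ≤ s → g s = 0)
    (hM : ∀ s, 0 ≤ s → s ≤ r → |g s| ≤ M) (w : ℝ) (x : X) :
    ‖weightedLaplace T g w x‖ ≤ M * r * ‖x‖ := by
  have hM0 : 0 ≤ M := (abs_nonneg _).trans (hM 0 le_rfl hr)
  rw [weightedLaplace, ← setIntegral_eq_integral_of_forall_compl_eq_zero (s := Icc 0 r)]
  · refine (norm_setIntegral_le_of_norm_le_const (C := M * ‖x‖) (by simp) fun s hs => ?_).trans ?_
    · refine (hT.norm_weighted_le g w s x).trans ?_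
      have := hM s hs.1 hs.2
      have h2 : Real.exp (-s) ≤ 1 := Real.exp_le_one_iff.2 (by linarith [hs.1])
      calc |g s| * Real.exp (-s) * ‖x‖ ≤ M * 1 * ‖x‖ := by gcongr
        _ = _ := by ring
    · simp [hr]
      linarith
  · intro s hs
    have : g s = 0 := by
      rcases lt_or_ge s 0 with h | h
      · exact h0 s h.le
      · exact h1 s (le_of_lt (not_le.1 fun h' => hs ⟨h, h'⟩))
    simp [this]

variable [CompleteSpace X]

theorem mul_norm_weightedLaplace_le {g : ℝ → ℝ} (hg : IsLaplaceWeight g) {ε : ℝ} (hε1 : ε ≤ 1)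
    {τ w : ℝ} (hτ : 0 ≤ τ) (hw : Complex.exp (-(w * Complex.I * τ)) = -1)
    (h : ‖1 - T τ‖ ≤ 2 - ε) (x : X) :
    ε * ‖weightedLaplace T g w x‖ ≤ ‖weightedLaplace T (fun s => g s - g (s - τ)) w x‖ := by
  set e : ℝ → ℂ := fun s => Complex.exp (-((1 + w * Complex.I) * s)) with he
  have hadd : ∀ s t : ℝ, e (s + t) = e s * e t := fun s t => by
    simp only [he, ← Complex.exp_add]
    congr 1
    push_cast
    ring
  have heτ : e τ = -(Real.exp (-τ) : ℂ) := by
    have : -((1 + w * Complex.I) * τ) = ((-τ : ℝ) : ℂ) + -(w * Complex.I * τ) := by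
      push_cast; ring
    simp only [he]
    rw [this, Complex.exp_add, hw, Complex.ofReal_exp]
    ring
  have htrans : T τ (weightedLaplace T g w x) =
      ∫ s : ℝ, ((g (s - τ) : ℂ) * e (s - τ)) • T (max s 0) x := by
    rw [weightedLaplace, ← ContinuousLinearMap.integral_comp_comm _ (hT.integrable_weighted hg w x),
      ← integral_add_right_eq_self
        (fun s : ℝ => ((g (s - τ) : ℂ) * e (s - τ)) • T (max s 0) x) τ]
    refine integral_congr_ae (ae_of_all _ fun s => ?_)
    simp only [add_sub_cancel_right, map_smul]
    rcases le_or_gt s 0 with hs | hs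
    · simp [hg.eq_zero s hs]
    · rw [max_eq_left hs.le, max_eq_left (by linarith), add_comm s τ, hT.map_add τ s hτ hs.le]
      rfl
  have hi1 := hT.integrable_weighted hg w x
  have hi2 := hT.integrable_weighted (hg.sub_translate hτ) w x
  have hkey : weightedLaplace T (fun s => g s - g (s - τ)) w x =
      weightedLaplace T g w x + (Real.exp (-τ) : ℂ) • T τ (weightedLaplace T g w x) := by
    have hpt : ∀ s : ℝ, (Real.exp (-τ) : ℂ) • (((g (s - τ) : ℂ) * e (s - τ)) • T (max s 0) x) =
        (((g s - g (s - τ) : ℝ) : ℂ) * e s) • T (max s 0) x - ((g s : ℂ) * e s) • T (max s 0) x := by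
      intro s
      have h1 : e s = e (s - τ) * e τ := by rw [← hadd, sub_add_cancel]
      rw [smul_smul, ← sub_smul, h1, heτ]
      congr 1
      push_cast
      ring
    rw [htrans, ← integral_smul, integral_congr_ae (ae_of_all _ hpt), integral_sub hi2 hi1]
    simp only [weightedLaplace]
    abel
  rw [hkey]
  exact mul_norm_le_norm_add_smul hε1 h (Real.exp_pos _).le
    (Real.exp_le_one_iff.2 (by linarith)) _

theorem cube_mul_norm_weightedLaplace_le {ε : ℝ} (hε : 0 < ε) (hε1 : ε ≤ 1)
    (h : ∀ t, 0 < t → ‖1 - T t‖ ≤ 2 - ε) (η : ℝ) (x : X) :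
    ε ^ 3 * (|η| ^ 3 * ‖weightedLaplace T (fun s => max s 0 ^ 2) (2 * Real.pi * η) x‖) ≤
      27 * ‖x‖ := by
  rcases eq_or_ne η 0 with rfl | hη
  · simp
  have hη0 : 0 < |η| := abs_pos.2 hη
  set τ : ℝ := 1 / (2 * |η|) with hτdef
  have hτ : 0 < τ := by positivity
  have hητ : |η| * τ = 1 / 2 := by rw [hτdef]; field_simp
  set w := 2 * Real.pi * η with hwdef
  have hw : Complex.exp (-(w * Complex.I * τ)) = -1 := by
    rcases le_total 0 η with h0 | h0
    · rw [abs_of_nonneg h0] at hητ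
      have : -((w : ℂ) * Complex.I * τ) = -(Real.pi * Complex.I) := by
        have : w * τ = Real.pi := by rw [hwdef]; linear_combination 2 * Real.pi * hητ
        rw [← this]; push_cast; ring
      rw [this, Complex.exp_neg, Complex.exp_pi_mul_I]
      norm_num
    · rw [abs_of_nonpos h0] at hητ
      have : -((w : ℂ) * Complex.I * τ) = Real.pi * Complex.I := by
        have : -(w * τ) = Real.pi := by rw [hwdef]; linear_combination 2 * Real.pi * hητ
        rw [← this]; push_cast; ring
      rw [this, Complex.exp_pi_mul_I]
  have hg0 := isLaplaceWeight_max_sq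
  have hg1 := hg0.sub_translate hτ.le
  have hg2 := hg1.sub_translate hτ.le
  have hg3 := hg2.sub_translate hτ.le
  have b0 := hT.mul_norm_weightedLaplace_le hg0 hε1 hτ.le hw (h τ hτ) x
  have b1 := hT.mul_norm_weightedLaplace_le hg1 hε1 hτ.le hw (h τ hτ) x
  have b2 := hT.mul_norm_weightedLaplace_le hg2 hε1 hτ.le hw (h τ hτ) x
  have hsq : ∀ u : ℝ, u ≤ 3 * τ → max u 0 ^ 2 ≤ 9 * τ ^ 2 := fun u hu => by
    calc max u 0 ^ 2 ≤ (3 * τ) ^ 2 := by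
          gcongr
          exact max_le hu (by positivity)
      _ = _ := by ring
  have b3 := hT.norm_weightedLaplace_le_of_support (r := 3 * τ) (M := 72 * τ ^ 2) (by positivity)
    hg3.eq_zero (fun s hs => by
      rw [max_eq_left (by linarith : 0 ≤ s), max_eq_left (by linarith : 0 ≤ s - τ),
        max_eq_left (by linarith : 0 ≤ s - τ - τ), max_eq_left (by linarith : 0 ≤ s - τ - τ - τ)]
      ring) (fun s hs hs' => by
      have h0 := hsq s hs'
      have h1 := hsq (s - τ) (by linarith)
      have h2 := hsq (s - τ - τ) (by linarith)
      have h3 := hsq (s - τ - τ - τ) (by linarith)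
      rw [abs_le]
      constructor <;> linarith [sq_nonneg (max s 0), sq_nonneg (max (s - τ) 0),
        sq_nonneg (max (s - τ - τ) 0), sq_nonneg (max (s - τ - τ - τ) 0)]) w x
  have hall : ε ^ 3 * ‖weightedLaplace T (fun s => max s 0 ^ 2) w x‖ ≤
      72 * τ ^ 2 * (3 * τ) * ‖x‖ := by
    refine le_trans ?_ b3
    calc ε ^ 3 * ‖weightedLaplace T (fun s => max s 0 ^ 2) w x‖
        = ε * (ε * (ε * ‖weightedLaplace T (fun s => max s 0 ^ 2) w x‖)) := by ring
      _ ≤ _ := (mul_le_mul_of_nonneg_left ((mul_le_mul_of_nonneg_left b0 hε.le).trans b1)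
        hε.le).trans b2
  calc ε ^ 3 * (|η| ^ 3 * ‖weightedLaplace T (fun s => max s 0 ^ 2) w x‖)
      = |η| ^ 3 * (ε ^ 3 * ‖weightedLaplace T (fun s => max s 0 ^ 2) w x‖) := by ring
    _ ≤ |η| ^ 3 * (72 * τ ^ 2 * (3 * τ) * ‖x‖) := by gcongr
    _ = 216 * (|η| * τ) ^ 3 * ‖x‖ := by ring
    _ = _ := by rw [hητ]; norm_num

end IsContractionSemigroup

end Semigroup

namespace IsContractionSemigroup

variable {X : Type*} [NormedAddCommGroup X] [NormedSpace ℂ X] [CompleteSpace X]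

omit [CompleteSpace X] in
theorem fourier_weighted_orbit (T : ℝ → X →L[ℂ] X) (g : ℝ → ℝ) (x : X) (η : ℝ) :
    𝓕 (fun s : ℝ => ((g s : ℂ) * Complex.exp (-s)) • T (max s 0) x) η =
      weightedLaplace T g (2 * Real.pi * η) x := by
  rw [Real.fourier_real_eq_integral_exp_smul, weightedLaplace]
  refine integral_congr_ae (ae_of_all _ fun s => ?_)
  simp only [smul_smul]
  congr 1
  rw [mul_left_comm, ← Complex.exp_add]
  congr 2
  push_cast
  ring

/-- The orbits of a contraction semigroup with `‖1 - T t‖ ≤ 2 - ε` for all `t > 0` are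
differentiable at `1`, with a bound on the derivative depending only on `ε`. -/
theorem exists_hasDerivAt_one {ε : ℝ} (hε : 0 < ε) (hε1 : ε ≤ 1) :
    ∃ C : ℝ, 0 < C ∧ ∀ T : ℝ → X →L[ℂ] X, IsContractionSemigroup T →
      (∀ t, 0 < t → ‖1 - T t‖ ≤ 2 - ε) → ∀ x : X,
      ∃ y, HasDerivAt (fun s => T s x) y 1 ∧ ‖y‖ ≤ C * ‖x‖ := by
  set I₀ : ℝ := ∫ s : ℝ, |max s 0 ^ 2| * Real.exp (-s) with hI₀
  have hI₀0 : 0 ≤ I₀ := integral_nonneg fun s => by positivity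
  set B : ℝ := I₀ + 27 / ε ^ 3 with hB
  have hB0 : 0 < B := by positivity
  set φ : ℝ → ℝ := fun s => Real.exp s / s ^ 2 with hφ
  have hφ1 : HasDerivAt φ (deriv φ 1) 1 := by
    refine DifferentiableAt.hasDerivAt ?_
    exact DifferentiableAt.div (by fun_prop) (by fun_prop) (by norm_num)
  refine ⟨|φ 1| * (4 * Real.pi ^ 2 * B) + |deriv φ 1| + 1, by positivity, fun T hT h x => ?_⟩
  set f : ℝ → X := fun s => (((max s 0 ^ 2 : ℝ) : ℂ) * Complex.exp (-s)) • T (max s 0) x with hf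
  have hfour : ∀ η, 𝓕 f η = weightedLaplace T (fun s => max s 0 ^ 2) (2 * Real.pi * η) x :=
    fourier_weighted_orbit T _ x
  have hfc : Continuous f := by
    have hc : Continuous fun s : ℝ => ((max s 0 ^ 2 : ℝ) : ℂ) * Complex.exp (-s) := by fun_prop
    exact hc.smul (hT.continuous_orbit x)
  have hfi : Integrable f := by
    refine (hT.integrable_weighted isLaplaceWeight_max_sq 0 x).congr (ae_of_all _ fun s => ?_)
    simp [hf]
  have hbound : ∀ η, (1 + |η| ^ 3) * ‖𝓕 f η‖ ≤ B * ‖x‖ := by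
    intro η
    have h1 := hT.norm_weightedLaplace_le isLaplaceWeight_max_sq (2 * Real.pi * η) x
    have h2 := hT.cube_mul_norm_weightedLaplace_le hε hε1 h η x
    rw [← hfour] at h1 h2
    rw [← le_div_iff₀' (by positivity)] at h2
    calc (1 + |η| ^ 3) * ‖𝓕 f η‖ = ‖𝓕 f η‖ + |η| ^ 3 * ‖𝓕 f η‖ := by ring
      _ ≤ I₀ * ‖x‖ + 27 * ‖x‖ / ε ^ 3 := add_le_add h1 h2
      _ = _ := by rw [hB]; ring
  have hb0 : ∀ η, ‖𝓕 f η‖ ≤ 2 * B * ‖x‖ * (1 + η ^ 2)⁻¹ := by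
    intro η
    rw [← div_eq_mul_inv, le_div_iff₀ (by positivity)]
    have h1 : 1 + η ^ 2 ≤ 2 * (1 + |η| ^ 3) := by
      rw [← sq_abs]
      nlinarith [abs_nonneg η, mul_nonneg (abs_nonneg η) (sq_nonneg (|η| - 1)),
        sq_nonneg (|η| - 1)]
    calc ‖𝓕 f η‖ * (1 + η ^ 2) ≤ ‖𝓕 f η‖ * (2 * (1 + |η| ^ 3)) := by gcongr
      _ = 2 * ((1 + |η| ^ 3) * ‖𝓕 f η‖) := by ring
      _ ≤ 2 * (B * ‖x‖) := mul_le_mul_of_nonneg_left (hbound η) zero_le_two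
      _ = _ := by ring
  have hb1 : ∀ η : ℝ, |η| * ‖𝓕 f η‖ ≤ 2 * B * ‖x‖ * (1 + η ^ 2)⁻¹ := by
    intro η
    rw [← div_eq_mul_inv, le_div_iff₀ (by positivity)]
    have h1 : |η| * (1 + η ^ 2) ≤ 2 * (1 + |η| ^ 3) := by
      rw [← sq_abs]
      nlinarith [abs_nonneg η, mul_nonneg (abs_nonneg η) (sq_nonneg (|η| - 1)),
        sq_nonneg (|η| - 1)]
    calc |η| * ‖𝓕 f η‖ * (1 + η ^ 2) = ‖𝓕 f η‖ * (|η| * (1 + η ^ 2)) := by ring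
      _ ≤ ‖𝓕 f η‖ * (2 * (1 + |η| ^ 3)) := by gcongr
      _ = 2 * ((1 + |η| ^ 3) * ‖𝓕 f η‖) := by ring
      _ ≤ 2 * (B * ‖x‖) := mul_le_mul_of_nonneg_left (hbound η) zero_le_two
      _ = _ := by ring
  have hFc : Continuous (𝓕 f) :=
    VectorFourier.fourierIntegral_continuous Real.continuous_fourierChar
      (innerSL ℝ).continuous₂ hfi
  have hdom : Integrable fun η : ℝ => 2 * B * ‖x‖ * (1 + η ^ 2)⁻¹ :=
    integrable_inv_one_add_sq.const_mul _
  have hFi : Integrable (𝓕 f) := hdom.mono' hFc.aestronglyMeasurable (ae_of_all _ hb0)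
  have hFi' : Integrable fun η : ℝ => η • 𝓕 f η :=
    hdom.mono' (continuous_id.smul hFc).aestronglyMeasurable (ae_of_all _ fun η => by
      simpa [norm_smul] using hb1 η)
  have hinv : 𝓕⁻ (𝓕 f) = f := hfc.fourierInv_fourier_eq hfi hFi
  set d : X := 𝓕 (fun η : ℝ => (-2 * Real.pi * Complex.I * η) • 𝓕 f η) (-1) with hd
  have hfd : HasDerivAt f (-d) 1 := by
    have h1 := Real.hasDerivAt_fourier hFi hFi' (-1)
    have h2 : HasDerivAt (fun s : ℝ => -s) (-1) 1 := hasDerivAt_neg 1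
    have h3 := HasDerivAt.scomp (1 : ℝ) h1 h2
    rw [neg_one_smul] at h3
    refine h3.congr_of_eventuallyEq (Eventually.of_forall fun s => ?_)
    rw [← congrFun hinv s, Real.fourierInv_eq_fourier_neg]
    rfl
  have hdn : ‖d‖ ≤ 4 * Real.pi ^ 2 * B * ‖x‖ := by
    refine (VectorFourier.norm_fourierIntegral_le_integral_norm _ _ _ _ _).trans ?_
    calc ∫ η : ℝ, ‖(-2 * Real.pi * Complex.I * η : ℂ) • 𝓕 f η‖
        ≤ ∫ η : ℝ, 2 * Real.pi * (2 * B * ‖x‖ * (1 + η ^ 2)⁻¹) := by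
          refine integral_mono_of_nonneg (ae_of_all _ fun η => norm_nonneg _)
            (hdom.const_mul _) (ae_of_all _ fun η => ?_)
          simp only [norm_smul, norm_mul, norm_neg, Complex.norm_I, Complex.norm_real,
            Complex.norm_ofNat, Real.norm_eq_abs, abs_of_pos Real.pi_pos, mul_one]
          rw [mul_assoc (2 * Real.pi)]
          exact mul_le_mul_of_nonneg_left (hb1 η) (by positivity)
      _ = _ := by
          rw [integral_const_mul, integral_const_mul, integral_univ_inv_one_add_sq]
          ring
  refine ⟨φ 1 • (-d) + deriv φ 1 • f 1, ?_, ?_⟩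
  · refine (hφ1.smul hfd).congr_of_eventuallyEq ?_
    filter_upwards [lt_mem_nhds (zero_lt_one' ℝ)] with s hs
    have hs' : (s : ℂ) ≠ 0 := by exact_mod_cast hs.ne'
    change T s x = φ s • f s
    simp only [hf, hφ, max_eq_left hs.le]
    rw [← Complex.coe_smul, smul_smul]
    push_cast
    rw [Complex.exp_neg]
    have := Complex.exp_ne_zero (s : ℂ)
    rw [show Complex.exp s / (s : ℂ) ^ 2 * ((s : ℂ) ^ 2 * (Complex.exp s)⁻¹) = 1 by field_simp,
      one_smul]
  · have hf1 : ‖f 1‖ ≤ ‖x‖ := by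
      have h1 := hT.norm_weighted_le (fun s => max s 0 ^ 2) 0 1 x
      have h2 : Real.exp (-1) ≤ 1 := Real.exp_le_one_iff.2 (by norm_num)
      have h3 : ‖f 1‖ ≤ Real.exp (-1) * ‖x‖ := by simpa [hf] using h1
      nlinarith [norm_nonneg x]
    refine (norm_add_le _ _).trans ?_
    rw [norm_smul, norm_smul, norm_neg, Real.norm_eq_abs, Real.norm_eq_abs]
    calc |φ 1| * ‖d‖ + |deriv φ 1| * ‖f 1‖
        ≤ |φ 1| * (4 * Real.pi ^ 2 * B * ‖x‖) + |deriv φ 1| * ‖x‖ := by gcongr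
      _ ≤ _ := by nlinarith [norm_nonneg x]

variable {T : ℝ → X →L[ℂ] X}

omit [CompleteSpace X] in
theorem rescale (hT : IsContractionSemigroup T) {a : ℝ} (ha : 0 ≤ a) :
    IsContractionSemigroup fun s => T (a * s) where
  map_zero := by simp [hT.map_zero]
  map_add s t hs ht := by
    rw [mul_add]
    exact hT.map_add _ _ (mul_nonneg ha hs) (mul_nonneg ha ht)
  norm_le t ht := hT.norm_le _ (mul_nonneg ha ht)
  continuousOn x := (hT.continuousOn x).comp (by fun_prop) fun s hs => mul_nonneg ha hs

/-- Under the hypothesis of the Beurling–Kato criterion, the semigroup is strongly differentiable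
on `(0, ∞)`, with derivative `O(1 / t)`. -/
theorem exists_strong_deriv (hT : IsContractionSemigroup T) {ε : ℝ} (hε : 0 < ε) (hε1 : ε ≤ 1)
    (h : ∀ t, 0 < t → ‖1 - T t‖ ≤ 2 - ε) :
    ∃ (C : ℝ) (D : ℝ → X →L[ℂ] X), 0 < C ∧
      ∀ t, 0 < t → ‖D t‖ ≤ C / t ∧ ∀ x, HasDerivAt (fun s => T s x) (D t x) t := by
  obtain ⟨C, hC, hCT⟩ := exists_hasDerivAt_one (X := X) hε hε1
  have hex : ∀ t, 0 < t → ∃ A : X →L[ℂ] X, ‖A‖ ≤ C / t ∧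
      ∀ x, HasDerivAt (fun s => T s x) (A x) t := by
    intro t ht
    have hd : ∀ x, ∃ y, HasDerivAt (fun s => T s x) y t ∧ ‖y‖ ≤ C / t * ‖x‖ := by
      intro x
      obtain ⟨y, hy, hyn⟩ := hCT _ (hT.rescale ht.le) (fun s hs => h _ (mul_pos ht hs)) x
      refine ⟨t⁻¹ • y, ?_, ?_⟩
      · have h1 : HasDerivAt (fun s : ℝ => t⁻¹ * s) t⁻¹ t := by
          simpa using (hasDerivAt_id t).const_mul t⁻¹
        have hone : t⁻¹ * t = 1 := inv_mul_cancel₀ ht.ne'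
        rw [← hone] at hy
        refine (HasDerivAt.scomp t hy h1).congr_of_eventuallyEq (Eventually.of_forall fun s => ?_)
        simp [ht.ne']
      · rw [norm_smul, Real.norm_of_nonneg (by positivity)]
        calc t⁻¹ * ‖y‖ ≤ t⁻¹ * (C * ‖x‖) := by gcongr
          _ = _ := by ring
    choose A hA hAn using hd
    refine ⟨LinearMap.mkContinuous
      { toFun := A
        map_add' := fun x y => (hA (x + y)).unique <|
          ((hA x).add (hA y)).congr_of_eventuallyEq (Eventually.of_forall fun s => by simp)
        map_smul' := fun c x => (hA (c • x)).unique <|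
          ((hA x).const_smul c).congr_of_eventuallyEq (Eventually.of_forall fun s => by simp) }
      (C / t) hAn, ?_, hA⟩
    exact LinearMap.mkContinuous_norm_le _ (by positivity) _
  choose! D hD using hex
  exact ⟨C, D, hC, hD⟩

omit [CompleteSpace X] in
theorem strong_deriv_add (hT : IsContractionSemigroup T) {D : ℝ → X →L[ℂ] X}
    (hD : ∀ t, 0 < t → ∀ x, HasDerivAt (fun s => T s x) (D t x) t) {s u : ℝ}
    (hs : 0 < s) (hu : 0 ≤ u) : D (s + u) = D s * T u ∧ D (s + u) = T u * D s := by
  have hsu : u < s + u := by linarith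
  have hsub : HasDerivAt (fun v : ℝ => v - u) 1 (s + u) := (hasDerivAt_id _).sub_const u
  have hDs : ∀ x, HasDerivAt (fun v => T v x) (D s x) (s + u - u) := fun x => by
    rw [add_sub_cancel_right]
    exact hD s hs x
  constructor
  · ext x
    refine (hD (s + u) (by linarith) x).unique ?_
    have h1 := HasDerivAt.scomp (s + u) (hDs (T u x)) hsub
    rw [one_smul] at h1
    refine h1.congr_of_eventuallyEq ?_
    filter_upwards [lt_mem_nhds hsu] with v hv
    have := hT.map_add (v - u) u (by linarith) hu
    rw [sub_add_cancel] at this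
    rw [this]
    rfl
  · ext x
    refine (hD (s + u) (by linarith) x).unique ?_
    have h1 := HasDerivAt.scomp (s + u) (hDs x) hsub
    rw [one_smul] at h1
    have h2 := ((T u).restrictScalars ℝ).hasFDerivAt.comp_hasDerivAt (s + u) h1
    refine h2.congr_of_eventuallyEq ?_
    filter_upwards [lt_mem_nhds hsu] with v hv
    have := hT.map_add u (v - u) hu (by linarith)
    rw [add_sub_cancel] at this
    rw [this]
    rfl

omit [CompleteSpace X] in
theorem hasDerivAt_of_strong_deriv (hT : IsContractionSemigroup T) {D : ℝ → X →L[ℂ] X} {C : ℝ}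
    (hC : 0 < C) (hDn : ∀ t, 0 < t → ‖D t‖ ≤ C / t)
    (hD : ∀ t, 0 < t → ∀ x, HasDerivAt (fun s => T s x) (D t x) t) {t : ℝ} (ht : 0 < t) :
    HasDerivAt T (D t) t := by
  have hLip : ∀ r s u : ℝ, 0 < r → r ≤ s → r ≤ u → ‖T s - T u‖ ≤ C / r * |s - u| := by
    intro r s u hr hs hu
    refine ContinuousLinearMap.opNorm_le_bound _ (by positivity) fun x => ?_
    have := Convex.norm_image_sub_le_of_norm_hasDerivWithin_le (f := fun v => T v x)
      (f' := fun v => D v x) (s := Ici r) (C := C / r * ‖x‖)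
      (fun v hv => (hD v (hr.trans_le hv) x).hasDerivWithinAt)
      (fun v hv => (D v).le_of_opNorm_le ((hDn v (hr.trans_le hv)).trans
        (div_le_div_of_nonneg_left hC.le hr hv)) x) (convex_Ici r) hu hs
    calc ‖(T s - T u) x‖ ≤ C / r * ‖x‖ * ‖s - u‖ := this
      _ = _ := by rw [Real.norm_eq_abs]; ring
  set L : ℝ := C / (t / 2) * (C / (t / 4)) with hL
  have hDLip : ∀ s : ℝ, 3 * t / 4 ≤ s → ‖D s - D t‖ ≤ L * |s - t| := by
    intro s hs
    have h1 := (hT.strong_deriv_add hD (s := t / 2) (u := s - t / 2) (by positivity)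
      (by linarith)).1
    have h2 := (hT.strong_deriv_add hD (s := t / 2) (u := t - t / 2) (by positivity)
      (by linarith)).1
    rw [add_sub_cancel] at h1 h2
    rw [h1, h2, ← mul_sub]
    have h3 := hLip (t / 4) (s - t / 2) (t - t / 2) (by positivity) (by linarith) (by linarith)
    rw [sub_sub_sub_cancel_right] at h3
    calc ‖D (t / 2) * (T (s - t / 2) - T (t - t / 2))‖
        ≤ ‖D (t / 2)‖ * ‖T (s - t / 2) - T (t - t / 2)‖ := norm_mul_le _ _
      _ ≤ C / (t / 2) * (C / (t / 4) * |s - t|) := by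
          gcongr
          exact hDn _ (by positivity)
      _ = _ := by rw [hL]; ring
  rw [hasDerivAt_iff_isLittleO]
  have hO : (fun s => T s - T t - (s - t) • D t) =O[𝓝 t] fun s => ‖s - t‖ ^ 2 := by
    refine Asymptotics.IsBigO.of_bound L ?_
    filter_upwards [lt_mem_nhds (by linarith : 3 * t / 4 < t)] with s hs
    refine ContinuousLinearMap.opNorm_le_bound _ (by positivity) fun x => ?_
    have hmem : ∀ v ∈ uIcc t s, 3 * t / 4 ≤ v ∧ |v - t| ≤ |s - t| := fun v hv =>
      ⟨(le_inf (by linarith) hs.le).trans hv.1, abs_sub_left_of_mem_uIcc hv⟩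
    have := Convex.norm_image_sub_le_of_norm_hasDerivWithin_le
      (f := fun v => T v x - v • D t x) (f' := fun v => D v x - D t x) (s := uIcc t s)
      (C := L * |s - t| * ‖x‖)
      (fun v hv => by
        have h1 := (hD v (by linarith [(hmem v hv).1]) x).sub
          ((hasDerivAt_id v).smul_const (D t x))
        rw [one_smul] at h1
        exact h1.hasDerivWithinAt)
      (fun v hv => by
        refine (D v - D t).le_of_opNorm_le ((hDLip v (hmem v hv).1).trans ?_) x
        have := (hmem v hv).2
        gcongr) (convex_uIcc t s) left_mem_uIcc right_mem_uIcc
    calc ‖(T s - T t - (s - t) • D t) x‖ = ‖(T s x - s • D t x) - (T t x - t • D t x)‖ := by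
          congr 1
          change T s x - T t x - (s - t) • D t x = _
          module
      _ ≤ L * |s - t| * ‖x‖ * ‖s - t‖ := this
      _ = _ := by rw [norm_pow, norm_norm, Real.norm_eq_abs]; ring
  exact hO.trans_isLittleO (Asymptotics.isLittleO_pow_sub_sub t one_lt_two)

/-- The **Beurling–Kato criterion**: a strongly continuous contraction semigroup with
`‖1 - T t‖ ≤ 2 - ε` for all `t > 0` is bounded analytic. -/
theorem bounded_analytic (hT : IsContractionSemigroup T) {ε : ℝ} (hε : 0 < ε) (hε1 : ε ≤ 1)
    (h : ∀ t, 0 < t → ‖1 - T t‖ ≤ 2 - ε) :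
    ∃ θ : ℝ, 0 < θ ∧ θ < Real.pi / 2 ∧ ∃ S : ℂ → X →L[ℂ] X,
      DifferentiableOn ℂ S {z : ℂ | z ≠ 0 ∧ |Complex.arg z| < θ} ∧
      (∃ C : ℝ, ∀ z ∈ {z : ℂ | z ≠ 0 ∧ |Complex.arg z| < θ}, ‖S z‖ ≤ C) ∧
      ∀ t : ℝ, 0 < t → S (t : ℂ) = T t := by
  obtain ⟨C, D, hC, hCD⟩ := hT.exists_strong_deriv hε hε1 h
  have hDn := fun t ht => (hCD t ht).1
  have hD := fun t ht => (hCD t ht).2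
  have hadd : ∀ {s u : ℝ}, 0 < s → 0 ≤ u → D (s + u) = D s * T u ∧ D (s + u) = T u * D s :=
    fun hs hu => hT.strong_deriv_add hD hs hu
  have hcomm : ∀ {s u : ℝ}, 0 < s → 0 ≤ u → Commute (D s) (T u) := fun hs hu =>
    (hadd hs hu).1.symm.trans (hadd hs hu).2
  have hTadd : ∀ {s u : ℝ}, 0 ≤ s → 0 ≤ u → T (s + u) = T s * T u :=
    fun hs hu => hT.map_add _ _ hs hu
  have hTcomm : ∀ {s u : ℝ}, 0 ≤ s → 0 ≤ u → Commute (T s) (T u) := fun {s u} hs hu => by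
    rw [commute_iff_eq, ← hTadd hs hu, ← hTadd hu hs, add_comm]
  have hTpow : ∀ (n : ℕ) {u : ℝ}, 0 ≤ u → T u ^ n = T (n * u) := by
    intro n u hu
    induction n with
    | zero => simp [hT.map_zero]
    | succ n ih =>
      rw [pow_succ, ih, ← hTadd (by positivity) hu]
      push_cast
      ring_nf
  set G : ℕ → ℝ → X →L[ℂ] X := fun n t => D (t / (n + 1)) ^ n * T (t / (n + 1)) with hG
  obtain ⟨θ, h1, h2, S, h3, h4, h5⟩ := exists_bounded_holomorphic_extension G
    (M := Real.exp 1) (K := Real.exp 1 * C) (by positivity) (fun n t ht => by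
      set p : ℝ := t / (n + 2) with hp
      have hp0 : 0 < p := by positivity
      have hr : t = (n + 1) * p + p := by rw [hp]; field_simp; ring
      have hGloc : ∀ v, (n + 1) * p < v → G n v = D p ^ n * T p * T (v - (n + 1) * p) := by
        intro v hv
        set u : ℝ := (v - (n + 1) * p) / (n + 1) with hu
        have hu0 : 0 ≤ u := div_nonneg (by linarith) (by positivity)
        have hvu : v / (n + 1) = p + u := by rw [hu]; field_simp; ring
        have hvu' : v - (n + 1) * p = (n + 1 : ℕ) * u := by rw [hu]; push_cast; field_simp
        simp only [hG]
        rw [hvu, hvu', (hadd hp0 hu0).1, hTadd hp0.le hu0, (hcomm hp0 hu0).mul_pow,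
          ← hTpow (n + 1) hu0, mul_assoc, mul_assoc, ← mul_assoc (T u ^ n),
          ((hTcomm hu0 hp0.le).pow_left n).eq, mul_assoc (T p), ← pow_succ]
      have hsub : HasDerivAt (fun v : ℝ => v - (n + 1) * p) 1 t := (hasDerivAt_id _).sub_const _
      have hTd : HasDerivAt T (D p) (t - (n + 1) * p) := by
        rw [show t - (n + 1) * p = p by linarith]
        exact hT.hasDerivAt_of_strong_deriv hC hDn hD hp0
      have hTd' := HasDerivAt.scomp t hTd hsub
      rw [one_smul] at hTd'
      have hder := hTd'.const_mul (D p ^ n * T p)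
      have hval : G (n + 1) t = D p ^ n * T p * D p := by
        simp only [hG]
        rw [mul_assoc, ← (hcomm hp0 hp0.le).eq, ← mul_assoc, ← pow_succ]
        push_cast
        rw [add_assoc, one_add_one_eq_two]
      rw [hval]
      refine hder.congr_of_eventuallyEq ?_
      filter_upwards [lt_mem_nhds (by linarith : (n + 1) * p < t)] with v hv
      exact hGloc v hv) (fun n t ht => by
      have hpos : 0 < t / (n + 1 : ℝ) := by positivity
      have hexp : ((n : ℝ) + 1) ^ n ≤ n.factorial * Real.exp (n + 1) := by
        rw [← div_le_iff₀' (by exact_mod_cast n.factorial_pos)]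
        exact Real.pow_div_factorial_le_exp _ (by positivity) n
      have hexp' : Real.exp (n + 1) = Real.exp 1 * Real.exp 1 ^ n := by
        rw [← Real.exp_nat_mul, ← Real.exp_add]; ring_nf
      calc ‖G n t‖ ≤ ‖D (t / (n + 1)) ^ n‖ * ‖T (t / (n + 1))‖ := norm_mul_le _ _
        _ ≤ (C / (t / (n + 1))) ^ n * 1 := by
          gcongr
          · rcases n with _ | n
            · rw [pow_zero, pow_zero]
              exact ContinuousLinearMap.norm_id_le
            · exact (norm_pow_le' _ n.succ_pos).trans (by gcongr; exact hDn _ hpos)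
          · exact hT.norm_le _ hpos.le
        _ = (n + 1 : ℝ) ^ n * (C / t) ^ n := by
          rw [mul_one, ← mul_pow]; congr 1; field_simp
        _ ≤ n.factorial * Real.exp (n + 1) * (C / t) ^ n := by gcongr
        _ = _ := by rw [hexp', mul_div_assoc, mul_pow]; ring)
  refine ⟨θ, h1, h2, S, h3, h4, fun t ht => ?_⟩
  rw [h5 t ht]
  simp [hG]

end IsContractionSemigroup

/-- **Analyticity via one-step dilations (Banach-space core of Theorem 3.6).**
Let `X, Y` be complex Banach spaces and suppose that, for some `λ > 1`, `Y` contains no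
subspace `λ`-isomorphic to `ℓ¹_2` (over the reals). Let `(T_t)_{t ≥ 0}` be a strongly
continuous semigroup of contractions on `X` such that for every `t > 0` there are
contractions `J : X → Y`, `Q : Y → X` with `Q ∘ J = Id_X` and a norm-one projection `P`
on `Y` with `T_t = Q ∘ P ∘ J`. Then `(T_t)_{t ≥ 0}` is bounded analytic. -/
theorem rota_dilation_bounded_analytic
    {X Y : Type*} [NormedAddCommGroup X] [NormedSpace ℂ X] [CompleteSpace X]
    [NormedAddCommGroup Y] [NormedSpace ℂ Y] [CompleteSpace Y]
    (lam : ℝ) (hlam : 1 < lam)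
    (hY : ¬ ∃ u : (PiLp 1 fun _ : Fin 2 => ℝ) →ₗ[ℝ] Y,
      ∀ x, ‖x‖ ≤ ‖u x‖ ∧ ‖u x‖ ≤ lam * ‖x‖)
    (T : ℝ → X →L[ℂ] X)
    (hT0 : T 0 = 1)
    (hTadd : ∀ s t : ℝ, 0 ≤ s → 0 ≤ t → T (s + t) = T s ∘L T t)
    (hTcontr : ∀ t : ℝ, 0 ≤ t → ‖T t‖ ≤ 1)
    (hTcont : ∀ x : X, ContinuousOn (fun t : ℝ => T t x) (Set.Ici (0 : ℝ)))
    (hdil : ∀ t : ℝ, 0 < t →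
      ∃ (J : X →L[ℂ] Y) (Q : Y →L[ℂ] X) (P : Y →L[ℂ] Y),
        ‖J‖ ≤ 1 ∧ ‖Q‖ ≤ 1 ∧ Q ∘L J = 1 ∧
        P ∘L P = P ∧ ‖P‖ = 1 ∧ T t = Q ∘L (P ∘L J)) :
    ∃ θ : ℝ, 0 < θ ∧ θ < Real.pi / 2 ∧
      ∃ S : ℂ → X →L[ℂ] X,
        DifferentiableOn ℂ S {z : ℂ | z ≠ 0 ∧ |Complex.arg z| < θ} ∧
        (∃ C : ℝ, ∀ z ∈ {z : ℂ | z ≠ 0 ∧ |Complex.arg z| < θ}, ‖S z‖ ≤ C) ∧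
        (∀ t : ℝ, 0 < t → S (t : ℂ) = T t) := by
  have hlam0 : 0 < lam := one_pos.trans hlam
  have hinv : lam⁻¹ < 1 := inv_lt_one_of_one_lt₀ hlam
  have hT : IsContractionSemigroup T := ⟨hT0, hTadd, hTcontr, hTcont⟩
  refine hT.bounded_analytic (ε := 1 - lam⁻¹) (by linarith)
    (by linarith [inv_pos.2 hlam0]) fun t ht => ?_
  obtain ⟨J, Q, P, hJ, hQ, hQJ, hPP, hP1, hTt⟩ := hdil t ht
  have hfac : 1 - T t = Q ∘L ((1 - P) ∘L J) := by
    rw [hTt, ← hQJ]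
    ext x
    simp
  have hbound := norm_one_sub_le_of_forall_not_ell_one hlam hY P hPP hP1.le
  calc ‖1 - T t‖ ≤ ‖Q‖ * (‖1 - P‖ * ‖J‖) := by
        rw [hfac]
        exact (ContinuousLinearMap.opNorm_comp_le _ _).trans
          (mul_le_mul_of_nonneg_left (ContinuousLinearMap.opNorm_comp_le _ _) (norm_nonneg _))
    _ ≤ 1 * ((1 + lam⁻¹) * 1) := by gcongr
    _ = 2 - (1 - lam⁻¹) := by ring
end
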